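/- arXiv:2412.13945 — 2 statements merged into one kernel-verified Lean document; each statement's English description precedes it below -/
import Mathlib

section
/- For every ε > 0 there exists N such that the following holds for all n ≥ N: if M₁, …, M_{n−1} are matchings in a bipartite graph (not necessarily distinct or disjoint), each consisting of at least (1 + ε)·n edges, then one can choose one edge eᵢ ∈ Mᵢ from each matching so that the chosen edges e₁, …, e_{n−1} are pairwise vertex-disjoint; that is, there is a rainbow matching of size n − 1 using one edge of each color class. -/
open Finset in
/-- The binomial moment generating identity: choosing each element of `G` independently with
probability `p`, the expectation of `z ^ |T ∩ S|` is `(1 - p + p z) ^ |T|`. -/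
theorem sum_powerset_weight_mul_pow {V : Type*} [DecidableEq V] {G T : Finset V} (hT : T ⊆ G)
    (p z : ℝ) :
    ∑ S ∈ G.powerset, p ^ #S * (1 - p) ^ #(G \ S) * z ^ #(T ∩ S) = (1 - p + p * z) ^ #T := by
  have h := Finset.prod_add (fun a => p * if a ∈ T then z else 1) (fun _ => 1 - p) G
  have hG : ∏ a ∈ G, ((p * if a ∈ T then z else 1) + (1 - p)) = (1 - p + p * z) ^ #T := by
    rw [← Finset.prod_const, ← Finset.prod_subset hT]
    · exact Finset.prod_congr rfl fun a ha => by rw [if_pos ha]; ring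
    · intro a _ ha
      rw [if_neg ha]; ring
  rw [← hG, h]
  refine Finset.sum_congr rfl fun S _ => ?_
  rw [Finset.prod_mul_distrib, Finset.prod_const, Finset.prod_const, Finset.prod_ite,
    Finset.prod_const, Finset.prod_const, one_pow, mul_one, Finset.filter_mem_eq_inter,
    Finset.inter_comm]
  ring

open Finset in
/-- A random sample with density `p` meets many given large sets in many points and many given
small sets in few points, by exponential moments and a union bound. -/
theorem exists_sample {ι V : Type*} [Fintype ι] [DecidableEq V] (T U : ι → Finset V)
    {p t v l u : ℝ} (hp₀ : 0 ≤ p) (hp₁ : p ≤ 1) (hT : ∀ i, t ≤ #(T i)) (hU : ∀ i, #(U i) ≤ v)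
    (h : Fintype.card ι * (Real.exp (l - p * t / 2) + Real.exp (2 * p * v - u)) < 1) :
    ∃ S : Finset V, ∀ i, l ≤ #(T i ∩ S) ∧ #(U i ∩ S) ≤ u := by
  by_contra! hS
  set G : Finset V := univ.biUnion fun i => T i ∪ U i
  have hTG : ∀ i, T i ⊆ G := fun i =>
    subset_union_left.trans (subset_biUnion_of_mem (fun i => T i ∪ U i) (mem_univ i))
  have hUG : ∀ i, U i ⊆ G := fun i =>
    subset_union_right.trans (subset_biUnion_of_mem (fun i => T i ∪ U i) (mem_univ i))
  set w : Finset V → ℝ := fun S => p ^ #S * (1 - p) ^ #(G \ S)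
  have hw : ∀ S, 0 ≤ w S := fun S => by
    have : 0 ≤ 1 - p := by linarith
    positivity
  have h1 : ∑ S ∈ G.powerset, w S = 1 := by
    simpa using sum_powerset_weight_mul_pow (empty_subset G) p 1
  have hTi : ∀ i, ∑ S ∈ G.powerset, w S * Real.exp (l - #(T i ∩ S)) ≤
      Real.exp (l - p * t / 2) := by
    intro i
    have e1 : ∀ S, w S * Real.exp (l - #(T i ∩ S)) =
        Real.exp l * (w S * Real.exp (-1) ^ #(T i ∩ S)) := fun S => by
      rw [← Real.exp_nat_mul, sub_eq_add_neg, Real.exp_add]; ring_nf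
    have he : Real.exp (-1) ≤ 1 / 2 := by
      rw [Real.exp_neg, ← one_div]
      have := Real.add_one_le_exp (1 : ℝ)
      exact one_div_le_one_div_of_le (by norm_num) (by linarith)
    have hle : 1 - p + p * Real.exp (-1) ≤ Real.exp (-(p / 2)) := by
      have := Real.add_one_le_exp (-(p / 2))
      nlinarith
    have h0 : 0 ≤ 1 - p + p * Real.exp (-1) := by
      have := Real.exp_pos (-1)
      nlinarith
    rw [Finset.sum_congr rfl fun S _ => e1 S, ← Finset.mul_sum,
      sum_powerset_weight_mul_pow (hTG i), sub_eq_add_neg l, Real.exp_add]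
    refine mul_le_mul_of_nonneg_left ((pow_le_pow_left₀ h0 hle _).trans ?_) (Real.exp_pos _).le
    rw [← Real.exp_nat_mul, Real.exp_le_exp]
    nlinarith [hT i]
  have hUi : ∀ i, ∑ S ∈ G.powerset, w S * Real.exp (#(U i ∩ S) - u) ≤
      Real.exp (2 * p * v - u) := by
    intro i
    have e1 : ∀ S, w S * Real.exp (#(U i ∩ S) - u) =
        Real.exp (-u) * (w S * Real.exp 1 ^ #(U i ∩ S)) := fun S => by
      rw [← Real.exp_nat_mul, sub_eq_add_neg, Real.exp_add]; ring_nf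
    have hle : 1 - p + p * Real.exp 1 ≤ Real.exp (2 * p) := by
      have := Real.add_one_le_exp (2 * p)
      have := Real.exp_one_lt_d9
      nlinarith
    have h0 : 0 ≤ 1 - p + p * Real.exp 1 := by
      have := Real.exp_pos 1
      nlinarith
    rw [Finset.sum_congr rfl fun S _ => e1 S, ← Finset.mul_sum,
      sum_powerset_weight_mul_pow (hUG i), sub_eq_neg_add _ u, Real.exp_add]
    refine mul_le_mul_of_nonneg_left ((pow_le_pow_left₀ h0 hle _).trans ?_) (Real.exp_pos _).le
    rw [← Real.exp_nat_mul, Real.exp_le_exp]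
    nlinarith [hU i]
  have hbound : ∀ S, 1 ≤ ∑ i, (Real.exp (l - #(T i ∩ S)) + Real.exp (#(U i ∩ S) - u)) := by
    intro S
    obtain ⟨i, hi⟩ := hS S
    refine le_trans ?_ (Finset.single_le_sum
      (f := fun i => Real.exp (l - #(T i ∩ S)) + Real.exp (#(U i ∩ S) - u))
      (fun i _ => by positivity) (mem_univ i))
    have p1 := Real.exp_pos (l - #(T i ∩ S))
    have p2 := Real.exp_pos (#(U i ∩ S) - u)
    by_cases hl : l ≤ #(T i ∩ S)
    · have := Real.one_le_exp (sub_nonneg.2 (hi hl).le)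
      linarith
    · have := Real.one_le_exp (sub_nonneg.2 (not_le.1 hl).le)
      linarith
  have : (1 : ℝ) ≤ Fintype.card ι * (Real.exp (l - p * t / 2) + Real.exp (2 * p * v - u)) :=
    calc (1 : ℝ) = ∑ S ∈ G.powerset, w S * 1 := by simp only [mul_one, h1]
      _ ≤ ∑ S ∈ G.powerset,
          w S * ∑ i, (Real.exp (l - #(T i ∩ S)) + Real.exp (#(U i ∩ S) - u)) :=
        Finset.sum_le_sum fun S _ => mul_le_mul_of_nonneg_left (hbound S) (hw S)
      _ = ∑ i, (∑ S ∈ G.powerset, w S * Real.exp (l - #(T i ∩ S)) +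
            ∑ S ∈ G.powerset, w S * Real.exp (#(U i ∩ S) - u)) := by
        simp only [Finset.mul_sum, mul_add]
        rw [Finset.sum_comm]
        simp only [Finset.sum_add_distrib]
      _ ≤ ∑ _i : ι, (Real.exp (l - p * t / 2) + Real.exp (2 * p * v - u)) :=
        Finset.sum_le_sum fun i _ => add_le_add (hTi i) (hUi i)
      _ = _ := by simp [mul_add]
  linarith

/-- A finite set of pairs, seen as a set of edges of a bipartite graph, is a matching. -/
def IsBipartiteMatching {X Y : Type*} (M : Finset (X × Y)) : Prop :=
  Set.InjOn Prod.fst (M : Set (X × Y)) ∧ Set.InjOn Prod.snd (M : Set (X × Y))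

theorem IsBipartiteMatching.subset {X Y : Type*} {M M' : Finset (X × Y)}
    (h : IsBipartiteMatching M) (hM : M' ⊆ M) : IsBipartiteMatching M' :=
  ⟨h.1.mono (Finset.coe_subset.2 hM), h.2.mono (Finset.coe_subset.2 hM)⟩

/-- The edges `e i`, for colors `i ∈ J`, form a rainbow matching in the family `M`. -/
structure IsRainbow {ι X Y : Type*} (M : ι → Finset (X × Y)) (J : Finset ι) (e : ι → X × Y) :
    Prop where
  mem : ∀ i ∈ J, e i ∈ M i
  fst : ∀ i ∈ J, ∀ j ∈ J, (e i).1 = (e j).1 → i = j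
  snd : ∀ i ∈ J, ∀ j ∈ J, (e i).2 = (e j).2 → i = j

namespace IsRainbow

variable {ι X Y : Type*} {M : ι → Finset (X × Y)} {J J' : Finset ι} {e e' : ι → X × Y}

theorem mono (h : IsRainbow M J e) (hJ : J' ⊆ J) : IsRainbow M J' e :=
  ⟨fun i hi => h.mem i (hJ hi), fun i hi j hj => h.fst i (hJ hi) j (hJ hj),
    fun i hi j hj => h.snd i (hJ hi) j (hJ hj)⟩

theorem mono_family {M' : ι → Finset (X × Y)} (h : IsRainbow M J e) (hM : ∀ i, M i ⊆ M' i) :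
    IsRainbow M' J e :=
  ⟨fun i hi => hM i (h.mem i hi), h.fst, h.snd⟩

/-- Two rainbow matchings on disjoint sets of colors and of vertices can be put together. -/
theorem union [DecidableEq ι] (h : IsRainbow M J e) (h' : IsRainbow M J' e')
    (hJ : Disjoint J J') (hfst : ∀ i ∈ J, ∀ j ∈ J', (e i).1 ≠ (e' j).1)
    (hsnd : ∀ i ∈ J, ∀ j ∈ J', (e i).2 ≠ (e' j).2) :
    IsRainbow M (J ∪ J') (fun i => if i ∈ J then e i else e' i) := by
  have hJ' : ∀ i ∈ J', i ∉ J := fun i hi hi' => Finset.disjoint_left.1 hJ hi' hi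
  refine ⟨fun i hi => ?_, fun i hi j hj => ?_, fun i hi j hj => ?_⟩ <;>
    simp only [Finset.mem_union] at *
  · rcases hi with hi | hi
    · simpa [hi] using h.mem i hi
    · simpa [hJ' i hi] using h'.mem i hi
  · rcases hi with hi | hi <;> rcases hj with hj | hj
    · simpa [hi, hj] using h.fst i hi j hj
    · simpa [hi, hJ' j hj] using fun heq => absurd heq (hfst i hi j hj)
    · simpa [hj, hJ' i hi] using fun heq => absurd heq.symm (hfst j hj i hi)
    · simpa [hJ' i hi, hJ' j hj] using h'.fst i hi j hj
  · rcases hi with hi | hi <;> rcases hj with hj | hj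
    · simpa [hi, hj] using h.snd i hi j hj
    · simpa [hi, hJ' j hj] using fun heq => absurd heq (hsnd i hi j hj)
    · simpa [hj, hJ' i hi] using fun heq => absurd heq.symm (hsnd j hj i hi)
    · simpa [hJ' i hi, hJ' j hj] using h'.snd i hi j hj

/-- Adding one edge, of a new color and with new end points, to a rainbow matching. -/
theorem insert [DecidableEq ι] (h : IsRainbow M J e) {c : ι} (hc : c ∉ J) {a : X × Y}
    (ha : a ∈ M c) (hfst : ∀ i ∈ J, (e i).1 ≠ a.1) (hsnd : ∀ i ∈ J, (e i).2 ≠ a.2) :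
    IsRainbow M (insert c J) (Function.update e c a) := by
  have hne : ∀ i ∈ J, i ≠ c := fun i hi hic => hc (hic ▸ hi)
  refine ⟨fun i hi => ?_, fun i hi j hj => ?_, fun i hi j hj => ?_⟩ <;>
    simp only [Finset.mem_insert] at *
  · rcases hi with rfl | hi
    · simpa using ha
    · simpa [hne i hi] using h.mem i hi
  · rcases hi with rfl | hi <;> rcases hj with rfl | hj
    · simp
    · simpa [hne j hj] using fun heq => absurd heq.symm (hfst j hj)
    · simpa [hne i hi] using fun heq => absurd heq (hfst i hi)
    · simpa [hne i hi, hne j hj] using h.fst i hi j hj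
  · rcases hi with rfl | hi <;> rcases hj with rfl | hj
    · simp
    · simpa [hne j hj] using fun heq => absurd heq.symm (hsnd j hj)
    · simpa [hne i hi] using fun heq => absurd heq (hsnd i hi)
    · simpa [hne i hi, hne j hj] using h.snd i hi j hj

end IsRainbow

open Finset in
theorem IsBipartiteMatching.card_filter_fst_mem_le {X Y : Type*} [DecidableEq X]
    {M : Finset (X × Y)} (hM : IsBipartiteMatching M) (S : Finset X) :
    #{a ∈ M | a.1 ∈ S} ≤ #S :=
  Finset.card_le_card_of_injOn Prod.fst (fun _ ha => (Finset.mem_filter.1 ha).2)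
    (hM.1.mono fun _ ha => (Finset.mem_filter.1 ha).1)

open Finset in
theorem IsBipartiteMatching.card_filter_snd_mem_le {X Y : Type*} [DecidableEq Y]
    {M : Finset (X × Y)} (hM : IsBipartiteMatching M) (S : Finset Y) :
    #{a ∈ M | a.2 ∈ S} ≤ #S :=
  Finset.card_le_card_of_injOn Prod.snd (fun _ ha => (Finset.mem_filter.1 ha).2)
    (hM.2.mono fun _ ha => (Finset.mem_filter.1 ha).1)

open Finset in
/-- If every color in `C` has at least `2 |C|` edges, a rainbow matching is found greedily. -/
theorem exists_isRainbow_of_two_mul_card_le {ι X Y : Type*} [DecidableEq ι] [Nonempty (X × Y)]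
    {M : ι → Finset (X × Y)} (hM : ∀ i, IsBipartiteMatching (M i)) (C : Finset ι)
    (hC : ∀ i ∈ C, 2 * #C ≤ #(M i)) : ∃ e, IsRainbow M C e := by
  classical
  induction C using Finset.induction_on with
  | empty =>
    exact ⟨fun _ => Classical.arbitrary _, by simp, by simp, by simp⟩
  | insert c C hc ih =>
    rw [Finset.card_insert_of_notMem hc] at hC
    obtain ⟨e, he⟩ := ih fun i hi => by
      have := hC i (Finset.mem_insert_of_mem hi)
      omega
    have h1 := (hM c).card_filter_fst_mem_le (C.image fun i => (e i).1)
    have h2 := (hM c).card_filter_snd_mem_le (C.image fun i => (e i).2)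
    have h3 : #(C.image fun i => (e i).1) ≤ #C := Finset.card_image_le
    have h4 : #(C.image fun i => (e i).2) ≤ #C := Finset.card_image_le
    have h5 := hC c (Finset.mem_insert_self c C)
    set P : Finset (X × Y) := {a ∈ M c | a.1 ∈ C.image fun i => (e i).1} with hP
    set Q : Finset (X × Y) := {a ∈ M c | a.2 ∈ C.image fun i => (e i).2} with hQ
    have h6 := Finset.card_union_le P Q
    obtain ⟨a, ha, ha'⟩ : ∃ a ∈ M c, a ∉ P ∪ Q :=
      Finset.exists_mem_notMem_of_card_lt_card (by omega)
    simp only [hP, hQ, Finset.mem_union, Finset.mem_filter, ha, true_and, Finset.mem_image, not_or,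
      not_exists, not_and] at ha'
    exact ⟨_, he.insert hc ha ha'.1 ha'.2⟩

open Finset in
/-- Along augmenting paths using the missing colors `C`, a maximum rainbow matching can be
modified so as to free the `X`-ends of all edges with color in a set `A` of size `d |C|`. -/
theorem IsRainbow.exists_freeable {ι X Y : Type*} [Fintype ι] [DecidableEq ι]
    {M : ι → Finset (X × Y)} (hM : ∀ i, IsBipartiteMatching (M i)) {d : ℕ}
    (hd : ∀ i, Fintype.card ι + d ≤ #(M i)) {J : Finset ι} {e : ι → X × Y}
    (he : IsRainbow M J e) (hmax : ∀ J' e', IsRainbow M J' e' → #J' ≤ #J)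
    (C : Finset ι) (hC : Disjoint C J) :
    ∃ A ⊆ J, #C * d ≤ #A ∧ ∀ x, (∀ i ∈ J \ A, (e i).1 ≠ x) →
      ∃ J' e', IsRainbow M J' e' ∧ #J' = #J ∧ J' ⊆ J ∪ C ∧ (∀ i ∈ J \ A, i ∈ J' ∧ e' i = e i) ∧
        (∀ i ∈ J', ∃ j ∈ J, (e' i).2 = (e j).2) ∧ ∀ i ∈ J', (e' i).1 ≠ x := by
  classical
  induction C using Finset.induction_on with
  | empty =>
    refine ⟨∅, by simp, by simp, fun x hx => ⟨J, e, he, rfl, by simp, by simp,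
      fun i hi => ⟨i, hi, rfl⟩, by simpa using hx⟩⟩
  | insert c C hc ih =>
    obtain ⟨hcJ, hCJ⟩ := Finset.disjoint_insert_left.1 hC
    obtain ⟨A, hAJ, hA, hfree⟩ := ih hCJ
    set W := {a ∈ M c | ∀ i ∈ J \ A, (e i).1 ≠ a.1} with hW
    set B := {b ∈ J | ∃ a ∈ W, a.2 = (e b).2} with hB
    have hcJ' : ∀ J', J' ⊆ J ∪ C → c ∉ J' := fun J' hJ' hcJ' => by
      rcases Finset.mem_union.1 (hJ' hcJ') with h | h
      exacts [hcJ h, hc h]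
    have hWY : ∀ a ∈ W, ∃ b ∈ J, a.2 = (e b).2 := by
      intro a ha
      by_contra! hne
      obtain ⟨haM, hax⟩ := Finset.mem_filter.1 ha
      obtain ⟨J', e', h1, h2, h3, -, h5, h6⟩ := hfree a.1 hax
      have := hmax _ _ (h1.insert (hcJ' J' h3) haM h6 fun i hi heq => by
        obtain ⟨j, hj, hij⟩ := h5 i hi
        exact hne j hj (heq.symm.trans hij))
      rw [Finset.card_insert_of_notMem (hcJ' J' h3)] at this
      omega
    have hWcard : d + #A ≤ #W := by
      have h1 := (hM c).card_filter_fst_mem_le ((J \ A).image fun i => (e i).1)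
      have h2 : #((J \ A).image fun i => (e i).1) ≤ #(J \ A) := Finset.card_image_le
      have h3 := Finset.card_sdiff_add_card_eq_card hAJ
      have h4 := Finset.card_le_univ J
      have h5 := hd c
      have h6 := Finset.card_filter_add_card_filter_not (s := M c)
        (fun a => a.1 ∈ (J \ A).image fun i => (e i).1)
      have h7 : {a ∈ M c | ¬ a.1 ∈ (J \ A).image fun i => (e i).1} = W := by
        rw [hW]
        refine Finset.filter_congr fun a _ => ?_
        simp only [Finset.mem_image, not_exists, not_and, ne_eq]
      rw [h7] at h6
      omega
    have hBcard : #W ≤ #B := by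
      have h1 : W.image Prod.snd ⊆ B.image fun b => (e b).2 := by
        intro y hy
        obtain ⟨a, ha, rfl⟩ := Finset.mem_image.1 hy
        obtain ⟨b, hb, hab⟩ := hWY a ha
        exact Finset.mem_image.2 ⟨b, Finset.mem_filter.2 ⟨hb, a, ha, hab⟩, hab.symm⟩
      rw [← Finset.card_image_of_injOn ((hM c).2.mono (Finset.coe_subset.2
        (Finset.filter_subset _ _)) : Set.InjOn Prod.snd (W : Set (X × Y)))]
      exact (Finset.card_le_card h1).trans Finset.card_image_le
    refine ⟨A ∪ B, Finset.union_subset hAJ (Finset.filter_subset _ _), ?_, fun x hx => ?_⟩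
    · rw [Finset.card_insert_of_notMem hc, add_mul, one_mul]
      have := Finset.card_le_card (Finset.subset_union_right : B ⊆ A ∪ B)
      omega
    · by_cases hxA : ∀ i ∈ J \ A, (e i).1 ≠ x
      · obtain ⟨J', e', h1, h2, h3, h4, h5, h6⟩ := hfree x hxA
        exact ⟨J', e', h1, h2, h3.trans (Finset.union_subset_union_right
          (Finset.subset_insert _ _)), fun i hi => h4 i (Finset.sdiff_subset_sdiff subset_rfl
          Finset.subset_union_left hi), h5, h6⟩
      push Not at hxA
      obtain ⟨b, hb, rfl⟩ := hxA
      have hbB : b ∈ B := by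
        by_contra hbB
        refine hx b ?_ rfl
        simp only [Finset.mem_sdiff, Finset.mem_union] at hb ⊢
        tauto
      obtain ⟨hbJ, a, haW, hab⟩ := Finset.mem_filter.1 hbB
      obtain ⟨haM, hax⟩ := Finset.mem_filter.1 haW
      obtain ⟨J', e', h1, h2, h3, h4, h5, h6⟩ := hfree a.1 hax
      obtain ⟨hbJ', heb⟩ := h4 b hb
      have hcE : c ∉ J'.erase b := fun h => hcJ' J' h3 (Finset.mem_of_mem_erase h)
      have hne : ∀ i ∈ J'.erase b, i ≠ c := fun i hi hic => hcE (hic ▸ hi)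
      refine ⟨_, _, (h1.mono (Finset.erase_subset b J')).insert hcE haM
        (fun i hi => h6 i (Finset.mem_of_mem_erase hi)) ?_, ?_, ?_, ?_, ?_, ?_⟩
      · intro i hi heq
        refine Finset.ne_of_mem_erase hi (h1.snd i (Finset.mem_of_mem_erase hi) b hbJ' ?_)
        rw [heq, heb, hab]
      · rw [Finset.card_insert_of_notMem hcE, Finset.card_erase_add_one hbJ', h2]
      · intro i hi
        rcases Finset.mem_insert.1 hi with rfl | hi
        · simp
        · have := h3 (Finset.mem_of_mem_erase hi)
          simp only [Finset.mem_union, Finset.mem_insert] at this ⊢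
          tauto
      · intro i hi
        have hiA : i ∈ J \ A := Finset.sdiff_subset_sdiff subset_rfl
          Finset.subset_union_left hi
        have hib : i ≠ b := by
          rintro rfl
          simp [hbB] at hi
        have hiE : i ∈ J'.erase b := Finset.mem_erase.2 ⟨hib, (h4 i hiA).1⟩
        exact ⟨Finset.mem_insert_of_mem hiE, by
          rw [Function.update_of_ne (hne i hiE), (h4 i hiA).2]⟩
      · intro i hi
        rcases Finset.mem_insert.1 hi with rfl | hi
        · exact ⟨b, hbJ, by simp [hab]⟩
        · rw [Function.update_of_ne (hne i hi)]
          exact h5 i (Finset.mem_of_mem_erase hi)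
      · intro i hi
        rcases Finset.mem_insert.1 hi with rfl | hi
        · simpa using (hax b hb).symm
        · rw [Function.update_of_ne (hne i hi), ← heb]
          exact fun heq => Finset.ne_of_mem_erase hi
            (h1.fst i (Finset.mem_of_mem_erase hi) b hbJ' heq)

open Finset in
/-- A Woolbright-type bound: matchings with `d` more edges than there are colors have a rainbow
matching that misses at most a `1 / d` proportion of the colors. -/
theorem exists_isRainbow_card_compl_mul_le {ι X Y : Type*} [Fintype ι] [DecidableEq ι]
    [Nonempty (X × Y)] {M : ι → Finset (X × Y)} (hM : ∀ i, IsBipartiteMatching (M i)) {d : ℕ}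
    (hd : ∀ i, Fintype.card ι + d ≤ #(M i)) :
    ∃ J e, IsRainbow M J e ∧ #Jᶜ * d ≤ Fintype.card ι := by
  obtain ⟨J, ⟨e, he⟩, hmax⟩ := Set.Finite.exists_maximalFor (Finset.card : Finset ι → ℕ)
    {J | ∃ e, IsRainbow M J e} (Set.toFinite _)
    ⟨∅, fun _ => Classical.arbitrary _, by simp, by simp, by simp⟩
  have hmax' : ∀ J' e', IsRainbow M J' e' → #J' ≤ #J := fun J' e' h' => by
    by_contra! hlt
    exact absurd (hmax (j := J') ⟨e', h'⟩ hlt.le) (not_le.2 hlt)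
  obtain ⟨A, hAJ, hA, -⟩ := he.exists_freeable hM hd hmax' Jᶜ disjoint_compl_left
  exact ⟨J, e, he, hA.trans (Finset.card_le_univ A)⟩

open Finset in
/-- The conclusion holds as soon as the vertices can be split into two parts such that inside the
first one all matchings exceed the number of colors by `d`, and inside the second one all have at
least `2 k` edges, where `k d` exceeds the number of colors. -/
theorem exists_isRainbow_univ_of_split {ι X Y : Type*} [Fintype ι] [DecidableEq X]
    [DecidableEq Y] [Nonempty (X × Y)] {M : ι → Finset (X × Y)}
    (hM : ∀ i, IsBipartiteMatching (M i)) {S : Finset X} {T : Finset Y} {d : ℕ} {k : ℝ}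
    (hd : ∀ i, Fintype.card ι + d ≤ #{a ∈ M i | a.1 ∉ S ∧ a.2 ∉ T})
    (hk : ∀ i, 2 * k ≤ #{a ∈ M i | a.1 ∈ S ∧ a.2 ∈ T}) (hkd : Fintype.card ι < k * d) :
    ∃ e, IsRainbow M univ e := by
  classical
  obtain ⟨J, e, he, hJ⟩ := exists_isRainbow_card_compl_mul_le
    (fun i => (hM i).subset (Finset.filter_subset _ _)) hd
  have hJk : (#Jᶜ : ℝ) ≤ k := by
    have hJ' : (#Jᶜ : ℝ) * d ≤ Fintype.card ι := by exact_mod_cast hJ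
    exact (lt_of_mul_lt_mul_right (hJ'.trans_lt hkd) (Nat.cast_nonneg d)).le
  obtain ⟨f, hf⟩ := exists_isRainbow_of_two_mul_card_le
    (fun i => (hM i).subset (Finset.filter_subset _ _)) Jᶜ (fun i _ => by
      have : (2 * #Jᶜ : ℝ) ≤ #{a ∈ M i | a.1 ∈ S ∧ a.2 ∈ T} := by linarith [hk i]
      exact_mod_cast this)
  have hout := fun i hi => (Finset.mem_filter.1 (he.mem i hi)).2
  have hin := fun i hi => (Finset.mem_filter.1 (hf.mem i hi)).2
  have h := (he.mono_family fun i => Finset.filter_subset _ _).union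
    (hf.mono_family fun i => Finset.filter_subset _ _) disjoint_compl_right
    (fun i hi j hj heq => (hout i hi).1 (heq ▸ (hin j hj).1))
    (fun i hi j hj heq => (hout i hi).2 (heq ▸ (hin j hj).2))
  rw [Finset.union_compl] at h
  exact ⟨_, h⟩

open Filter Topology in
theorem eventually_nat_mul_exp_lt {c : ℝ} (hc : 0 < c) (b : ℝ) {η : ℝ} (hη : 0 < η) :
    ∀ᶠ n : ℕ in atTop, (n : ℝ) * Real.exp (b - c * n) < η := by
  have h := (Real.tendsto_pow_mul_exp_neg_atTop_nhds_zero 1).comp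
    ((tendsto_natCast_atTop_atTop (R := ℝ)).const_mul_atTop hc)
  have h2 := h.const_mul (Real.exp b / c)
  rw [mul_zero] at h2
  filter_upwards [h2.eventually_lt_const hη] with n hn
  have e : (n : ℝ) * Real.exp (b - c * n) =
      Real.exp b / c * ((c * n) ^ 1 * Real.exp (-(c * n))) := by
    rw [sub_eq_add_neg, Real.exp_add]
    field_simp
  rw [e]
  exact hn

open Finset in
/-- Sampling vertices with density `p`: if all matchings have between `n` and `3 n` edges, there
are `S` and `T` inside of which every matching has `l` edges, and which both meet at most `9 p n`
edges of every matching. -/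
theorem exists_vertex_sample {ι X Y : Type*} [Fintype ι] [DecidableEq X] [DecidableEq Y]
    {M : ι → Finset (X × Y)} (hM : ∀ i, IsBipartiteMatching (M i)) {n p l : ℝ}
    (hp₀ : 0 ≤ p) (hp₁ : p ≤ 1) (hn : ∀ i, n ≤ #(M i)) (hn' : ∀ i, #(M i) ≤ 3 * n)
    (h₁ : Fintype.card ι * (Real.exp (-(p * n / 4)) + Real.exp (-(3 * p * n))) < 1)
    (h₂ : Fintype.card ι * (Real.exp (l - p ^ 2 * n / 8) + Real.exp (-(3 * p * n))) < 1) :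
    ∃ (S : Finset X) (T : Finset Y), ∀ i, l ≤ #{a ∈ M i | a.1 ∈ S ∧ a.2 ∈ T} ∧
      #{a ∈ M i | a.1 ∈ S} ≤ 9 * p * n ∧ #{a ∈ M i | a.2 ∈ T} ≤ 9 * p * n := by
  have hfst : ∀ i, ∀ S : Finset X, #((M i).image Prod.fst ∩ S) = #{a ∈ M i | a.1 ∈ S} := by
    intro i S
    rw [← Finset.filter_mem_eq_inter, Finset.filter_image, Finset.card_image_of_injOn
      ((hM i).subset (Finset.filter_subset _ _)).1]
  have hsnd : ∀ N : Finset (X × Y), IsBipartiteMatching N → ∀ T : Finset Y,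
      #(N.image Prod.snd ∩ T) = #{a ∈ N | a.2 ∈ T} := by
    intro N hN T
    rw [← Finset.filter_mem_eq_inter, Finset.filter_image, Finset.card_image_of_injOn
      (hN.subset (Finset.filter_subset _ _)).2]
  obtain ⟨S, hS⟩ := exists_sample (fun i => (M i).image Prod.fst) (fun i => (M i).image Prod.fst)
    (t := n) (v := 3 * n) (l := p * n / 4) (u := 9 * p * n) hp₀ hp₁
    (fun i => by rw [Finset.card_image_of_injOn (hM i).1]; exact hn i)
    (fun i => by rw [Finset.card_image_of_injOn (hM i).1]; exact hn' i)
    (by convert h₁ using 4 <;> ring)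
  simp only [hfst] at hS
  have hMS : ∀ i, IsBipartiteMatching {a ∈ M i | a.1 ∈ S} :=
    fun i => (hM i).subset (Finset.filter_subset _ _)
  obtain ⟨T, hT⟩ := exists_sample (fun i => {a ∈ M i | a.1 ∈ S}.image Prod.snd)
    (fun i => (M i).image Prod.snd)
    (t := p * n / 4) (v := 3 * n) (l := l) (u := 9 * p * n) hp₀ hp₁
    (fun i => by rw [Finset.card_image_of_injOn (hMS i).2]; exact (hS i).1)
    (fun i => by rw [Finset.card_image_of_injOn (hM i).2]; exact hn' i)
    (by convert h₂ using 4 <;> ring)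
  refine ⟨S, T, fun i => ⟨?_, (hS i).2, ?_⟩⟩
  · have := (hT i).1
    rwa [hsnd _ (hMS i), Finset.filter_filter] at this
  · have := (hT i).2
    rwa [hsnd _ (hM i)] at this

/-- Pokrovskiy, approximate Aharoni–Berger: For every `ε > 0` there is `N`
such that for all `n ≥ N`: given `n - 1` matchings in a bipartite graph (edges modeled as
pairs in `X × Y`), each with at least `(1 + ε) n` edges, one can pick one edge from each
matching so that the chosen edges are pairwise vertex-disjoint, i.e., there is a rainbow
matching of size `n - 1` using each color class once. -/
theorem approximate_aharoni_berger (ε : ℝ) (hε : 0 < ε) :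
    ∃ N : ℕ, ∀ n : ℕ, N ≤ n →
      ∀ (X Y : Type*) (M : Fin (n - 1) → Finset (X × Y)),
        (∀ i, ∀ e ∈ M i, ∀ e' ∈ M i, e ≠ e' → e.1 ≠ e'.1 ∧ e.2 ≠ e'.2) →
        (∀ i, (1 + ε) * (n : ℝ) ≤ ((M i).card : ℝ)) →
        ∃ e : Fin (n - 1) → X × Y,
          (∀ i, e i ∈ M i) ∧
          (∀ i j, i ≠ j → (e i).1 ≠ (e j).1 ∧ (e i).2 ≠ (e j).2) := by
  set δ : ℝ := min ε 1
  have hδ₀ : 0 < δ := lt_min hε one_pos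
  have hδ₁ : δ ≤ 1 := min_le_right _ _
  have hδε : δ ≤ ε := min_le_left _ _
  set p : ℝ := δ / 72 with hp
  have hp₀ : 0 < p := by positivity
  have hη : (0 : ℝ) < 1 / 3 := by norm_num
  obtain ⟨N, hN⟩ := Filter.eventually_atTop.1
    (((eventually_nat_mul_exp_lt (c := p / 4) (by positivity) 0 hη).and
      (eventually_nat_mul_exp_lt (c := 3 * p) (by positivity) 0 hη)).and
      ((eventually_nat_mul_exp_lt (c := p ^ 2 / 8) (by positivity) (8 / δ) hη).and
      (Filter.eventually_ge_atTop ⌈4 / δ⌉₊)))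
  refine ⟨N, fun n hn X Y M hM hcard => ?_⟩
  obtain ⟨⟨hN₁, hN₂⟩, hN₃, hN₄⟩ := hN n hn
  have hnδ : 4 ≤ δ * n := by
    have := Nat.ceil_le.1 hN₄
    rwa [div_le_iff₀' hδ₀] at this
  have hn₀ : (4 : ℝ) ≤ n := by nlinarith
  have hn1 : 1 ≤ n := by
    have : (1 : ℝ) ≤ n := by linarith
    exact_mod_cast this
  have hcolors : ((Fintype.card (Fin (n - 1)) : ℕ) : ℝ) = n - 1 := by
    rw [Fintype.card_fin, Nat.cast_sub hn1, Nat.cast_one]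
  classical
  rcases isEmpty_or_nonempty (Fin (n - 1)) with hempty | ⟨⟨i₀⟩⟩
  · exact ⟨fun i => hempty.elim i, fun i => hempty.elim i, fun i => hempty.elim i⟩
  have hMM : ∀ i, IsBipartiteMatching (M i) := fun i =>
    ⟨fun a ha b hb hab => by_contra fun hne => (hM i a ha b hb hne).1 hab,
      fun a ha b hb hab => by_contra fun hne => (hM i a ha b hb hne).2 hab⟩
  have htrim : ∀ i, ∃ M' ⊆ M i, M'.card = ⌈(1 + δ) * (n : ℝ)⌉₊ := fun i =>
    Finset.exists_subset_card_eq (Nat.ceil_le.2 (le_trans (by gcongr) (hcard i)))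
  choose M' hM'M hM'card using htrim
  have hM' : ∀ i, IsBipartiteMatching (M' i) := fun i => (hMM i).subset (hM'M i)
  have hlow : ∀ i, (1 + δ) * (n : ℝ) ≤ (M' i).card := fun i => by
    rw [hM'card]; exact Nat.le_ceil _
  have hup : ∀ i, ((M' i).card : ℝ) ≤ 3 * n := fun i => by
    rw [hM'card]
    have := Nat.ceil_lt_add_one (a := (1 + δ) * (n : ℝ)) (by positivity)
    nlinarith
  obtain ⟨S, T, hST⟩ := exists_vertex_sample hM' (n := n) (p := p) (l := 8 / δ) hp₀.le
    (by rw [hp]; linarith) (fun i => le_trans (by nlinarith) (hlow i)) hup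
    (by
      rw [hcolors]
      have e1 : -(p * n / 4) = 0 - p / 4 * n := by ring
      have e2 : -(3 * p * n) = 0 - 3 * p * n := by ring
      rw [e1, e2]
      have p1 := Real.exp_pos (0 - p / 4 * n)
      have p2 := Real.exp_pos (0 - 3 * p * n)
      nlinarith)
    (by
      rw [hcolors]
      have e1 : 8 / δ - p ^ 2 * n / 8 = 8 / δ - p ^ 2 / 8 * n := by ring
      have e2 : -(3 * p * n) = 0 - 3 * p * n := by ring
      rw [e1, e2]
      have p1 := Real.exp_pos (8 / δ - p ^ 2 / 8 * n)
      have p2 := Real.exp_pos (0 - 3 * p * n)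
      nlinarith)
  have hXY : Nonempty (X × Y) := by
    have h : (0 : ℝ) < (M' i₀).card := lt_of_lt_of_le (by nlinarith) (hlow i₀)
    obtain ⟨a, -⟩ := Finset.card_pos.1 (Nat.cast_pos.1 h)
    exact ⟨a⟩
  have hd := Nat.floor_le (a := δ * n / 2) (by positivity)
  have hd' := Nat.lt_floor_add_one (δ * n / 2)
  obtain ⟨e, he⟩ := exists_isRainbow_univ_of_split hM' (S := S) (T := T)
    (d := ⌊δ * n / 2⌋₊) (k := 4 / δ)
    (fun i => by
      have h1 : (M' i).card ≤ {a ∈ M' i | a.1 ∉ S ∧ a.2 ∉ T}.card +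
          ({a ∈ M' i | a.1 ∈ S}.card + {a ∈ M' i | a.2 ∈ T}.card) := by
        refine le_trans (Finset.card_le_card ?_) ((Finset.card_union_le _ _).trans
          (Nat.add_le_add_left (Finset.card_union_le _ _) _))
        intro a ha
        simp only [Finset.mem_union, Finset.mem_filter, ha, true_and]
        tauto
      have h2 : ((M' i).card : ℝ) ≤ ({a ∈ M' i | a.1 ∉ S ∧ a.2 ∉ T}.card : ℝ) +
          ({a ∈ M' i | a.1 ∈ S}.card + {a ∈ M' i | a.2 ∈ T}.card) := by exact_mod_cast h1
      have h3 : ((Fintype.card (Fin (n - 1)) : ℕ) : ℝ) + (⌊δ * n / 2⌋₊ : ℝ) ≤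
          ({a ∈ M' i | a.1 ∉ S ∧ a.2 ∉ T}.card : ℝ) := by
        rw [hcolors]
        have h4 := (hST i).2
        have h5 : 9 * p * n = δ * n / 8 := by rw [hp]; ring
        rw [h5] at h4
        linarith [hlow i, h4.1, h4.2]
      exact_mod_cast h3)
    (fun i => le_trans (le_of_eq (by ring)) (hST i).1)
    (by
      have h1 : 4 / δ * (δ * n / 4) = n := by field_simp
      have h2 : 4 / δ * (δ * n / 4) ≤ 4 / δ * (⌊δ * n / 2⌋₊ : ℝ) :=
        mul_le_mul_of_nonneg_left (by linarith) (by positivity)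
      rw [hcolors]
      linarith)
  exact ⟨e, fun i => hM'M i (he.mem i (Finset.mem_univ i)), fun i j hij =>
    ⟨fun h => hij (he.fst i (Finset.mem_univ i) j (Finset.mem_univ j) h),
      fun h => hij (he.snd i (Finset.mem_univ i) j (Finset.mem_univ j) h)⟩⟩
end

section
/- For every ε > 0 there exists n₀ such that for all n ≥ n₀ the following holds: every edge-coloring of the complete bipartite graph K_{n,n} with n colors in which each color appears on exactly n edges contains a rainbow matching with at least (1 − ε)·n edges. -/
/-- The expectation of `F S`, where `S` is the random set that contains each entry `j` of the list
independently with probability `p j`. -/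
def listExp {J : Type*} [DecidableEq J] (p : J → ℝ) : List J → (Finset J → ℝ) → ℝ
  | [], F => F ∅
  | j :: l, F => p j * listExp p l (fun S => F (insert j S)) + (1 - p j) * listExp p l F

section ListExp

variable {J : Type*} [DecidableEq J] {p : J → ℝ}

lemma listExp_add (l : List J) (F G : Finset J → ℝ) :
    listExp p l (fun S => F S + G S) = listExp p l F + listExp p l G := by
  induction l generalizing F G with
  | nil => rfl
  | cons j l ih => simp only [listExp, ih]; ring

lemma listExp_const_mul (l : List J) (a : ℝ) (F : Finset J → ℝ) :
    listExp p l (fun S => a * F S) = a * listExp p l F := by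
  induction l generalizing F with
  | nil => rfl
  | cons j l ih => simp only [listExp, ih]; ring

lemma listExp_const (l : List J) (a : ℝ) : listExp p l (fun _ => a) = a := by
  induction l with
  | nil => rfl
  | cons j l ih => simp only [listExp, ih]; ring

lemma listExp_sum {ι : Type*} (l : List J) (s : Finset ι) (F : ι → Finset J → ℝ) :
    listExp p l (fun S => ∑ i ∈ s, F i S) = ∑ i ∈ s, listExp p l (F i) := by
  classical
  induction s using Finset.induction_on with
  | empty => simpa using listExp_const l 0
  | insert i s hi ih => simp only [Finset.sum_insert hi, listExp_add, ih]

lemma listExp_mono (hp : ∀ j, 0 ≤ p j ∧ p j ≤ 1) (l : List J) {F G : Finset J → ℝ}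
    (h : ∀ S, F S ≤ G S) : listExp p l F ≤ listExp p l G := by
  induction l generalizing F G with
  | nil => exact h _
  | cons j l ih =>
    simp only [listExp]
    have h1 := mul_le_mul_of_nonneg_left (ih fun S => h (insert j S)) (hp j).1
    have h2 := mul_le_mul_of_nonneg_left (ih h) (sub_nonneg.2 (hp j).2)
    linarith

lemma exists_listExp_le (hp : ∀ j, 0 ≤ p j ∧ p j ≤ 1) (l : List J) (F : Finset J → ℝ) :
    ∃ S, listExp p l F ≤ F S := by
  by_contra! h
  induction l generalizing F with
  | nil => exact lt_irrefl _ (h ∅)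
  | cons j l ih =>
    have key : ∀ G : Finset J → ℝ, ∃ S, listExp p l G ≤ G S := fun G => by
      by_contra! hG
      exact ih G hG
    obtain ⟨S, hS⟩ := key fun S => F (insert j S)
    obtain ⟨S', hS'⟩ := key F
    have h1 := h (insert j S)
    have h2 := h S'
    simp only [listExp] at h1 h2
    obtain ⟨hp0, hp1⟩ := hp j
    rcases le_total (listExp p l fun S => F (insert j S)) (listExp p l F) with hab | hab
    · nlinarith [mul_le_mul_of_nonneg_left hab hp0]
    · nlinarith [mul_le_mul_of_nonneg_left hab (sub_nonneg.2 hp1)]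

/-- An Efron–Stein inequality. -/
lemma listExp_sq_sub_le (hp : ∀ j, 0 ≤ p j ∧ p j ≤ 1) (l : List J) (F : Finset J → ℝ)
    (c : J → ℝ) (hc : ∀ j S, |F (insert j S) - F S| ≤ c j) :
    listExp p l (fun S => F S ^ 2) - listExp p l F ^ 2 ≤ (l.map fun j => p j * c j ^ 2).sum := by
  induction l generalizing F with
  | nil => simp [listExp]
  | cons j l ih =>
    have h0 := ih F hc
    have h1 := ih (fun S => F (insert j S)) (fun i S => by
      rw [Finset.insert_comm]; exact hc i (insert j S))
    have hd : |listExp p l (fun S => F (insert j S)) - listExp p l F| ≤ c j := by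
      have e : listExp p l (fun S => F (insert j S)) =
          listExp p l (fun S => F (insert j S) - F S) + listExp p l F := by
        rw [← listExp_add]; simp
      rw [e, add_sub_cancel_right, abs_le]
      constructor
      · rw [← listExp_const (p := p) l (-c j)]
        exact listExp_mono hp l fun S => (abs_le.1 (hc j S)).1
      · conv_rhs => rw [← listExp_const (p := p) l (c j)]
        exact listExp_mono hp l fun S => (abs_le.1 (hc j S)).2
    have hd2 := sq_le_sq' (abs_le.1 hd).1 (abs_le.1 hd).2
    simp only [listExp, List.map_cons, List.sum_cons]
    obtain ⟨hp0, hp1⟩ := hp j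
    set a := listExp p l (fun S => F (insert j S))
    set b := listExp p l F
    have k1 := mul_le_mul_of_nonneg_left h1 hp0
    have k0 := mul_le_mul_of_nonneg_left h0 (sub_nonneg.2 hp1)
    have k2 : p j * (1 - p j) * (a - b) ^ 2 ≤ p j * c j ^ 2 := by
      have := mul_le_mul_of_nonneg_left hd2 hp0
      nlinarith [mul_nonneg (mul_nonneg hp0 hp0) (sq_nonneg (a - b))]
    nlinarith

lemma listExp_max_sub_one_le (hp : ∀ j, 0 ≤ p j ∧ p j ≤ 1) (l : List J) (F : Finset J → ℝ)
    {s : ℝ} (hs : 0 < s) (h1 : listExp p l F ≤ 1)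
    (hv : listExp p l (fun S => F S ^ 2) - listExp p l F ^ 2 ≤ s ^ 2) :
    listExp p l (fun S => max (F S - 1) 0) ≤ s := by
  set m := listExp p l F with hm
  have key : ∀ S, max (F S - 1) 0 ≤
      (1 / (2 * s)) * F S ^ 2 + ((-m / s) * F S + (m ^ 2 / (2 * s) + s / 2)) := by
    intro S
    have e : (1 / (2 * s)) * F S ^ 2 + ((-m / s) * F S + (m ^ 2 / (2 * s) + s / 2)) =
        ((F S - m) ^ 2 + s ^ 2) / (2 * s) := by field_simp; ring
    rw [e, le_div_iff₀ (by positivity)]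
    rcases max_cases (F S - 1) 0 with ⟨h, _⟩ | ⟨h, _⟩ <;> rw [h]
    · nlinarith [sq_nonneg (F S - m - s)]
    · nlinarith [sq_nonneg (F S - m)]
  refine (listExp_mono hp l key).trans ?_
  rw [listExp_add, listExp_add, listExp_const, listExp_const_mul, listExp_const_mul, ← hm]
  have e : (1 / (2 * s)) * listExp p l (fun S => F S ^ 2) +
      ((-m / s) * m + (m ^ 2 / (2 * s) + s / 2)) =
      ((listExp p l (fun S => F S ^ 2) - m ^ 2) + s ^ 2) / (2 * s) := by field_simp; ring
  rw [e, div_le_iff₀ (by positivity)]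
  nlinarith

lemma listExp_mul (l : List J) (F G : Finset J → ℝ)
    (h : ∀ j, (∀ S, F (insert j S) = F S) ∨ ∀ S, G (insert j S) = G S) :
    listExp p l (fun S => F S * G S) = listExp p l F * listExp p l G := by
  induction l generalizing F G with
  | nil => rfl
  | cons j l ih =>
    have h0 := ih F G h
    simp only [listExp]
    rcases h j with hj | hj
    · have h1 := ih F (fun S => G (insert j S)) fun i => by
        rcases h i with hi | hi
        · exact Or.inl hi
        · right; intro S; rw [Finset.insert_comm]; exact hi _
      simp only [hj, h0, h1]; ring
    · have h1 := ih (fun S => F (insert j S)) G fun i => by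
        rcases h i with hi | hi
        · left; intro S; rw [Finset.insert_comm]; exact hi _
        · exact Or.inr hi
      simp only [hj, h0, h1]; ring

lemma listExp_disjoint (l : List J) (T : Finset J) :
    listExp p l (fun S => if Disjoint S T then 1 else 0) =
      (l.map fun j => if j ∈ T then 1 - p j else 1).prod := by
  induction l with
  | nil => simp [listExp]
  | cons j l ih =>
    simp only [listExp, List.map_cons, List.prod_cons, Finset.disjoint_insert_left]
    by_cases hj : j ∈ T
    · simp only [hj, not_true, false_and, if_false, if_true, ih, listExp_const]; ring
    · simp only [hj, not_false_iff, true_and, if_false, ih]; ring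

lemma listExp_toList_disjoint [Fintype J] (T : Finset J) :
    listExp p Finset.univ.toList (fun S => if Disjoint S T then 1 else 0) =
      ∏ j ∈ T, (1 - p j) := by
  rw [listExp_disjoint, Finset.prod_map_toList, Finset.prod_ite_mem, Finset.univ_inter]

lemma listExp_toList_mem_disjoint [Fintype J] {g : J} {T : Finset J} (hg : g ∉ T) :
    listExp p Finset.univ.toList (fun S => if g ∈ S ∧ Disjoint S T then 1 else 0) =
      p g * ∏ j ∈ T, (1 - p j) := by
  have h1 : listExp p Finset.univ.toList (fun S => if g ∈ S then 1 else 0) = p g := by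
    have e : (fun S : Finset J => if g ∈ S then (1 : ℝ) else 0) =
        fun S => 1 + (-1) * (if Disjoint S {g} then 1 else 0) := by
      ext S
      by_cases h : g ∈ S <;> simp [h]
    rw [e, listExp_add, listExp_const, listExp_const_mul, listExp_toList_disjoint]
    simp
  rw [← h1, ← listExp_toList_disjoint, ← listExp_mul]
  · congr 1
    ext S
    by_cases h : g ∈ S <;> simp [h]
  · intro j
    by_cases hj : j = g
    · subst hj; right; intro S; simp [Finset.disjoint_insert_left, hg]
    · left; intro S; simp [Finset.mem_insert, Ne.symm hj]

end ListExp

lemma one_sub_sum_le_prod_one_sub {ι : Type*} (s : Finset ι) (f : ι → ℝ)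
    (hf : ∀ i ∈ s, 0 ≤ f i ∧ f i ≤ 1) : 1 - ∑ i ∈ s, f i ≤ ∏ i ∈ s, (1 - f i) := by
  classical
  induction s using Finset.induction_on with
  | empty => simp
  | insert a s ha ih =>
    rw [Finset.sum_insert ha, Finset.prod_insert ha]
    have h1 := ih fun i hi => hf i (Finset.mem_insert_of_mem hi)
    obtain ⟨h2, h3⟩ := hf a (Finset.mem_insert_self _ _)
    have h4 : 0 ≤ ∑ i ∈ s, f i :=
      Finset.sum_nonneg fun i hi => (hf i (Finset.mem_insert_of_mem hi)).1
    nlinarith [mul_le_mul_of_nonneg_left h1 (sub_nonneg.2 h3), mul_nonneg h2 h4]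

section Hypergraph

variable {T E : Type*} [DecidableEq T] [Fintype E]

/-- The expected weight at `t` of the edges through `t`, given that `t` is present, when every other
vertex `t'` is present with probability `x t'`. -/
def load (V : E → Finset T) (x : T → ℝ) (y : E → ℝ) (t : T) : ℝ :=
  ∑ e with t ∈ V e, y e * ∏ t' ∈ (V e).erase t, x t'

lemma sum_sum_mem_comm [Fintype T] (V : E → Finset T) (f : E → T → ℝ) :
    ∑ e, ∑ t ∈ V e, f e t = ∑ t, ∑ e with t ∈ V e, f e t :=
  Finset.sum_comm' (by simp)

lemma sum_not_disjoint_le (V : E → Finset T) (B : Finset T) {y : E → ℝ} (hy : ∀ e, 0 ≤ y e) :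
    ∑ e with ¬ Disjoint (V e) B, y e ≤ ∑ t ∈ B, ∑ e with t ∈ V e, y e := by
  have h : ∑ t ∈ B, ∑ e with t ∈ V e, y e = ∑ e, ∑ t ∈ B with t ∈ V e, y e :=
    Finset.sum_comm' (by simp)
  rw [h, Finset.sum_filter]
  refine Finset.sum_le_sum fun e _ => ?_
  split_ifs with hd
  · exact Finset.sum_nonneg fun _ _ => hy e
  · obtain ⟨t, ht, htB⟩ := Finset.not_disjoint_iff.1 hd
    exact Finset.single_le_sum (f := fun _ => y e) (fun _ _ => hy e)
      (Finset.mem_filter.2 ⟨htB, ht⟩)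

/-- Edge weights may be lowered to make all loads at most one, losing only the excess. -/
lemma exists_le_load_le_one [Fintype T] (V : E → Finset T) {x : T → ℝ} {y : E → ℝ}
    (hx : ∀ t, 0 ≤ x t) (hy : ∀ e, 0 ≤ y e) :
    ∃ y' : E → ℝ, (∀ e, 0 ≤ y' e ∧ y' e ≤ y e) ∧ (∀ t, load V x y' t ≤ 1) ∧
      ∑ e, y e * ∏ t ∈ V e, x t - ∑ t, x t * max (load V x y t - 1) 0 ≤
        ∑ e, y' e * ∏ t ∈ V e, x t := by
  set r : T → ℝ := fun t => 1 / max 1 (load V x y t) with hr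
  have hm : ∀ t, 1 ≤ max 1 (load V x y t) := fun t => le_max_left _ _
  have hr0 : ∀ t, 0 ≤ r t := fun t => by
    have := hm t
    exact div_nonneg zero_le_one (by linarith)
  have hr1 : ∀ t, r t ≤ 1 := fun t => by
    have := hm t
    rw [hr]; simp only; rw [div_le_one (by linarith)]; exact this
  have hpr : ∀ B : Finset T, 0 ≤ ∏ t ∈ B, r t := fun B => Finset.prod_nonneg fun t _ => hr0 t
  have hpr1 : ∀ B : Finset T, ∏ t ∈ B, r t ≤ 1 :=
    fun B => Finset.prod_le_one (fun t _ => hr0 t) fun t _ => hr1 t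
  have hpx : ∀ B : Finset T, 0 ≤ ∏ t ∈ B, x t := fun B => Finset.prod_nonneg fun t _ => hx t
  refine ⟨fun e => y e * ∏ t ∈ V e, r t, fun e => ⟨mul_nonneg (hy e) (hpr _), ?_⟩, ?_, ?_⟩
  · exact mul_le_of_le_one_right (hy e) (hpr1 _)
  · intro t
    have h1 : load V x (fun e => y e * ∏ t ∈ V e, r t) t ≤ r t * load V x y t := by
      unfold load
      rw [Finset.mul_sum]
      refine Finset.sum_le_sum fun e he => ?_
      have ht : t ∈ V e := (Finset.mem_filter.1 he).2
      beta_reduce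
      rw [← Finset.mul_prod_erase _ r ht]
      have := mul_le_mul_of_nonneg_left (hpr1 ((V e).erase t))
        (mul_nonneg (mul_nonneg (hy e) (hpx ((V e).erase t))) (hr0 t))
      nlinarith
    refine h1.trans ?_
    have := hm t
    rw [hr]; simp only; rw [one_div_mul_eq_div, div_le_one (by linarith)]
    exact le_max_right _ _
  · have hexc : ∀ t, max (load V x y t - 1) 0 = (1 - r t) * load V x y t := by
      intro t
      rw [hr]; simp only
      rcases le_total (load V x y t) 1 with h | h
      · rw [max_eq_right (by linarith), max_eq_left h]; simp
      · rw [max_eq_left (by linarith), max_eq_right h]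
        have : load V x y t ≠ 0 := by linarith
        field_simp
    have hsum : ∑ t, x t * max (load V x y t - 1) 0 =
        ∑ e, (y e * ∏ t ∈ V e, x t) * ∑ t ∈ V e, (1 - r t) := by
      simp_rw [Finset.mul_sum]
      rw [sum_sum_mem_comm]
      refine Finset.sum_congr rfl fun t _ => ?_
      rw [hexc, load, Finset.mul_sum, Finset.mul_sum]
      refine Finset.sum_congr rfl fun e he => ?_
      rw [← Finset.mul_prod_erase _ _ (Finset.mem_filter.1 he).2]
      ring
    rw [hsum, ← Finset.sum_sub_distrib]
    refine Finset.sum_le_sum fun e _ => ?_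
    have h1 := one_sub_sum_le_prod_one_sub (V e) (fun t => 1 - r t)
      fun t _ => ⟨by linarith [hr1 t], by linarith [hr0 t]⟩
    simp only [sub_sub_cancel] at h1
    have := mul_le_mul_of_nonneg_left h1 (mul_nonneg (hy e) (hpx (V e)))
    nlinarith

end Hypergraph

section Nibble

variable {T E : Type*} [DecidableEq T] [Fintype E]

lemma sum_mem_mem_not_disjoint_le (V : E → Finset T) {y : E → ℝ} {η : ℝ} (hη : 0 ≤ η)
    (hy : ∀ e, 0 ≤ y e)
    (hcod : ∀ t t', t ≠ t' → ∑ e with t ∈ V e ∧ t' ∈ V e, y e ≤ η) (t : T) (B : Finset T) {k : ℕ}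
    (hB : B.card ≤ k) :
    ∑ e with t ∈ V e ∧ ¬ Disjoint B ((V e).erase t), y e ≤ k * η := by
  have h : ∑ e with t ∈ V e ∧ ¬ Disjoint B ((V e).erase t), y e ≤
      ∑ w ∈ B.erase t, ∑ e with t ∈ V e ∧ w ∈ V e, y e := by
    have h1 : ∑ w ∈ B.erase t, ∑ e with t ∈ V e ∧ w ∈ V e, y e =
        ∑ e, ∑ w ∈ B.erase t with t ∈ V e ∧ w ∈ V e, y e :=
      Finset.sum_comm' (by simp)
    rw [h1, Finset.sum_filter]
    refine Finset.sum_le_sum fun e _ => ?_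
    by_cases hd : t ∈ V e ∧ ¬ Disjoint B ((V e).erase t)
    · rw [if_pos hd]
      obtain ⟨ht, hd⟩ := hd
      obtain ⟨w, hw, hwe⟩ := Finset.not_disjoint_iff.1 hd
      rw [Finset.mem_erase] at hwe
      exact Finset.single_le_sum (f := fun _ => y e) (fun _ _ => hy e)
        (Finset.mem_filter.2 ⟨Finset.mem_erase.2 ⟨hwe.1, hw⟩, ht, hwe.2⟩)
    · rw [if_neg hd]
      exact Finset.sum_nonneg fun _ _ => hy e
  refine h.trans ((Finset.sum_le_card_nsmul _ _ η fun w hw =>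
    hcod t w (Finset.ne_of_mem_erase hw).symm).trans ?_)
  rw [nsmul_eq_mul]
  have h2 : ((B.erase t).card : ℝ) ≤ k := by
    exact_mod_cast (Finset.card_erase_le).trans hB
  exact mul_le_mul_of_nonneg_right h2 hη

/-- One step of the semi-random method: some disjoint edges are selected, and the edges disjoint
from them are reweighted. -/
lemma exists_nibble_step [Fintype T] [DecidableEq E] (V : E → Finset T) (A : Finset T) (y : E → ℝ)
    {θ η s c : ℝ} (hθ : 0 < θ) (hθ1 : θ ≤ 1 / 6) (hη : 0 ≤ η) (hs : 0 < s)
    (hsη : 36 * η ≤ s ^ 2) (hc : 0 ≤ c)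
    (hy : ∀ e, 0 ≤ y e) (hV : ∀ e, (V e).Nonempty ∧ (V e).card ≤ 3)
    (hA : ∀ e, y e ≠ 0 → V e ⊆ A) (hload : ∀ t, ∑ e with t ∈ V e, y e ≤ 1)
    (hcod : ∀ t t', t ≠ t' → ∑ e with t ∈ V e ∧ t' ∈ V e, y e ≤ η) :
    ∃ (M : Finset E) (y' : E → ℝ), (∀ e, 0 ≤ y' e ∧ y' e ≤ 2 * y e) ∧
      (∀ e ∈ M, y e ≠ 0) ∧ (∀ e ∈ M, ∀ f ∈ M, e ≠ f → Disjoint (V e) (V f)) ∧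
      (∀ e, y' e ≠ 0 → ∀ f ∈ M, Disjoint (V f) (V e)) ∧
      (∀ t, ∑ e with t ∈ V e, y' e ≤ 1) ∧
      θ * (1 - 3 * θ) * ∑ e, y e + c * ((1 - θ) * ∑ e, y e - A.card * s) ≤
        M.card + c * ∑ e, y' e := by
  have hy1 : ∀ e, y e ≤ 1 := fun e => by
    obtain ⟨t, ht⟩ := (hV e).1
    exact (Finset.single_le_sum (f := y) (fun _ _ => hy _)
      (Finset.mem_filter.2 ⟨Finset.mem_univ e, ht⟩)).trans (hload t)
  set p : E → ℝ := fun e => θ * y e with hp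
  have hp01 : ∀ e, 0 ≤ p e ∧ p e ≤ 1 := fun e =>
    ⟨mul_nonneg hθ.le (hy e), by have := hy1 e; have := hy e; simp only [hp]; nlinarith⟩
  -- the edges meeting a set of vertices
  set N : Finset T → Finset E := fun B => Finset.univ.filter fun f => ¬ Disjoint (V f) B with hN
  have hNy : ∀ B, ∑ f ∈ N B, y f ≤ B.card := fun B => by
    refine (sum_not_disjoint_le V B hy).trans ((Finset.sum_le_card_nsmul _ _ 1 fun t _ =>
      hload t).trans ?_)
    simp
  set P : Finset E → ℝ := fun F => ∏ f ∈ F, (1 - p f) with hP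
  have hP1 : ∀ F, 1 - θ * ∑ f ∈ F, y f ≤ P F := fun F => by
    rw [Finset.mul_sum]
    exact one_sub_sum_le_prod_one_sub F p fun e _ => hp01 e
  have hP0 : ∀ F, 0 ≤ P F ∧ P F ≤ 1 := fun F =>
    ⟨Finset.prod_nonneg fun f _ => sub_nonneg.2 (hp01 f).2,
      Finset.prod_le_one (fun f _ => sub_nonneg.2 (hp01 f).2) fun f _ => by linarith [(hp01 f).1]⟩
  have hcard3 : ∀ e, ((V e).card : ℝ) ≤ 3 := fun e => by exact_mod_cast (hV e).2
  have hPe : ∀ e, 1 - 3 * θ ≤ P (N (V e)) := fun e => by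
    have h1 := hP1 (N (V e))
    have h2 := hNy (V e)
    have h3 := hcard3 e
    nlinarith
  set a : E → ℝ := fun e => y e * ((1 - θ) / P (N (V e))) with ha
  have hq : ∀ e, 0 ≤ (1 - θ) / P (N (V e)) ∧ (1 - θ) / P (N (V e)) ≤ 2 := fun e => by
    have := hPe e
    have h0 : 0 < P (N (V e)) := by linarith
    refine ⟨div_nonneg (by linarith) h0.le, ?_⟩
    rw [div_le_iff₀ h0]; linarith
  have ha0 : ∀ e, 0 ≤ a e ∧ a e ≤ 2 * y e := fun e =>
    ⟨mul_nonneg (hy e) (hq e).1, by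
      have := mul_le_mul_of_nonneg_left (hq e).2 (hy e); simp only [ha]; linarith⟩
  set Z : T → Finset E → ℝ := fun t S =>
    ∑ e with t ∈ V e, a e * (if Disjoint S (N ((V e).erase t)) then 1 else 0) with hZ
  -- expectation of the loads
  have hZ1 : ∀ t, listExp p Finset.univ.toList (Z t) ≤ 1 := by
    intro t
    simp only [hZ]
    rw [listExp_sum]
    refine le_trans (Finset.sum_le_sum fun e he => ?_) (hload t)
    rw [listExp_const_mul, listExp_toList_disjoint]
    have ht : t ∈ V e := (Finset.mem_filter.1 he).2
    change y e * ((1 - θ) / P (N (V e))) * P (N ((V e).erase t)) ≤ y e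
    have h0 : 0 < P (N (V e)) := by linarith [hPe e]
    have h1 : P (N {t}) * P (N ((V e).erase t)) ≤ P (N (V e)) := by
      have hsub : N (V e) ⊆ N {t} ∪ N ((V e).erase t) := by
        intro f hf
        simp only [hN, Finset.mem_filter, Finset.mem_univ, true_and, Finset.mem_union] at hf ⊢
        obtain ⟨w, hw, hwe⟩ := Finset.not_disjoint_iff.1 hf
        by_cases hwt : w = t
        · left; exact Finset.not_disjoint_iff.2 ⟨w, hw, by simp [hwt]⟩
        · right; exact Finset.not_disjoint_iff.2 ⟨w, hw, Finset.mem_erase.2 ⟨hwt, hwe⟩⟩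
      have h2 : P (N {t} ∪ N ((V e).erase t)) ≤ P (N (V e)) := by
        simp only [hP]
        rw [← Finset.prod_sdiff hsub]
        exact mul_le_of_le_one_left (hP0 _).1 (hP0 _).2
      have h3 : P (N {t}) * P (N ((V e).erase t)) ≤ P (N {t} ∪ N ((V e).erase t)) := by
        simp only [hP]
        rw [← Finset.prod_union_inter]
        exact mul_le_of_le_one_right (hP0 _).1 (hP0 _).2
      exact h3.trans h2
    have h4 : 1 - θ ≤ P (N {t}) := by
      have h5 := hP1 (N {t})
      have h6 := hNy {t}
      simp only [Finset.card_singleton, Nat.cast_one] at h6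
      nlinarith
    have h7 : (1 - θ) / P (N (V e)) * P (N ((V e).erase t)) ≤ 1 := by
      rw [div_mul_eq_mul_div, div_le_one h0]
      exact (mul_le_mul_of_nonneg_right h4 (hP0 _).1).trans h1
    rw [mul_assoc]
    exact mul_le_of_le_one_right (hy e) h7
  -- variance of the loads
  have hZv : ∀ t, listExp p Finset.univ.toList (fun S => Z t S ^ 2) -
      listExp p Finset.univ.toList (Z t) ^ 2 ≤ s ^ 2 := by
    intro t
    set b : E → ℝ := fun g => ∑ e with t ∈ V e ∧ ¬ Disjoint (V g) ((V e).erase t), a e with hb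
    have hb0 : ∀ g, 0 ≤ b g := fun g => Finset.sum_nonneg fun e _ => (ha0 e).1
    have hb6 : ∀ g, b g ≤ 6 * η := fun g => by
      have h1 := sum_mem_mem_not_disjoint_le V hη hy hcod t (V g) (hV g).2
      have h2 : b g ≤ ∑ e with t ∈ V e ∧ ¬ Disjoint (V g) ((V e).erase t), 2 * y e :=
        Finset.sum_le_sum fun e _ => (ha0 e).2
      rw [← Finset.mul_sum] at h2
      push_cast at h1
      linarith
    refine (listExp_sq_sub_le hp01 _ (Z t) b fun g S => ?_).trans ?_
    · simp only [hZ, hb]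
      rw [← Finset.sum_sub_distrib, ← Finset.filter_filter, Finset.sum_filter (fun e => ¬ _)]
      refine (Finset.abs_sum_le_sum_abs _ _).trans (Finset.sum_le_sum fun e _ => ?_)
      rw [← mul_sub, abs_mul, abs_of_nonneg (ha0 e).1]
      simp only [Finset.disjoint_insert_left]
      by_cases hg : Disjoint (V g) ((V e).erase t)
      · have : g ∉ N ((V e).erase t) := by simp [hN, hg]
        simp [this, hg]
      · have : g ∈ N ((V e).erase t) := by simp [hN, hg]
        simp only [this, not_true, false_and, if_false, hg, not_false_iff, if_true]
        refine mul_le_of_le_one_right (ha0 e).1 ?_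
        split_ifs <;> simp
    · rw [Finset.sum_map_toList]
      have h1 : ∀ g, p g * b g ^ 2 ≤ 6 * η * (y g * b g) := fun g => by
        have k1 : b g ^ 2 ≤ 6 * η * b g := by nlinarith [hb0 g, hb6 g]
        have k2 : p g ≤ y g := by simp only [hp]; nlinarith [hy g]
        calc p g * b g ^ 2 ≤ y g * b g ^ 2 := mul_le_mul_of_nonneg_right k2 (sq_nonneg _)
          _ ≤ y g * (6 * η * b g) := mul_le_mul_of_nonneg_left k1 (hy g)
          _ = _ := by ring
      have h2 : ∑ g, y g * b g ≤ 6 := by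
        have e1 : ∑ g, y g * b g = ∑ e with t ∈ V e, a e * ∑ g ∈ N ((V e).erase t), y g := by
          simp only [hb, hN, Finset.mul_sum]
          rw [Finset.sum_comm' (t' := Finset.univ.filter fun e => t ∈ V e)
            (s' := fun e => Finset.univ.filter fun g => ¬ Disjoint (V g) ((V e).erase t))
            (by simp [and_comm])]
          exact Finset.sum_congr rfl fun e _ => Finset.sum_congr rfl fun g _ => mul_comm _ _
        rw [e1]
        calc ∑ e with t ∈ V e, a e * ∑ g ∈ N ((V e).erase t), y g
            ≤ ∑ e with t ∈ V e, 6 * y e := by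
              refine Finset.sum_le_sum fun e _ => ?_
              have k1 := hNy ((V e).erase t)
              have k2 : (((V e).erase t).card : ℝ) ≤ 3 := by
                exact_mod_cast Finset.card_erase_le.trans (hV e).2
              have k3 : 0 ≤ ∑ g ∈ N ((V e).erase t), y g := Finset.sum_nonneg fun g _ => hy g
              have k4 := mul_le_mul (ha0 e).2 (k1.trans k2) k3 (by linarith [hy e])
              linarith
          _ ≤ 6 := by rw [← Finset.mul_sum]; linarith [hload t]
      calc ∑ g, p g * b g ^ 2 ≤ ∑ g, 6 * η * (y g * b g) := Finset.sum_le_sum fun g _ => h1 g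
        _ = 6 * η * ∑ g, y g * b g := by rw [Finset.mul_sum]
        _ ≤ 6 * η * 6 := mul_le_mul_of_nonneg_left h2 (by linarith)
        _ ≤ s ^ 2 := by linarith
  -- choose a good outcome
  set G : Finset E → ℝ := fun S =>
    (∑ g with y g ≠ 0, if g ∈ S ∧ Disjoint S ((N (V g)).erase g) then (1 : ℝ) else 0) +
    (c * (∑ e, a e * (if Disjoint S (N (V e)) then 1 else 0)) +
      (-c) * ∑ t ∈ A, max (Z t S - 1) 0) with hG
  obtain ⟨S, hS⟩ := exists_listExp_le hp01 Finset.univ.toList G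
  have hEG : θ * (1 - 3 * θ) * ∑ e, y e + c * ((1 - θ) * ∑ e, y e - A.card * s) ≤ G S := by
    refine le_trans ?_ hS
    simp only [hG]
    rw [listExp_add, listExp_add, listExp_const_mul, listExp_const_mul, listExp_sum, listExp_sum,
      listExp_sum]
    have h1 : θ * (1 - 3 * θ) * ∑ e, y e ≤ ∑ g with y g ≠ 0, listExp p Finset.univ.toList
        (fun S => if g ∈ S ∧ Disjoint S ((N (V g)).erase g) then (1 : ℝ) else 0) := by
      rw [Finset.mul_sum, Finset.sum_filter]
      refine Finset.sum_le_sum fun g _ => ?_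
      by_cases h0 : y g = 0
      · simp [h0]
      rw [if_pos h0, listExp_toList_mem_disjoint (Finset.notMem_erase _ _)]
      have k1 : 1 - 3 * θ ≤ P ((N (V g)).erase g) := by
        have k2 := hP1 ((N (V g)).erase g)
        have k3 : ∑ f ∈ (N (V g)).erase g, y f ≤ 3 :=
          (Finset.sum_le_sum_of_subset_of_nonneg (Finset.erase_subset _ _)
            fun f _ _ => hy f).trans ((hNy _).trans (hcard3 g))
        nlinarith
      have k4 := mul_le_mul_of_nonneg_left k1 (hp01 g).1
      change _ ≤ p g * P ((N (V g)).erase g)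
      simp only [hp] at k4 ⊢
      nlinarith
    have h2 : ∑ e, listExp p Finset.univ.toList
        (fun S => a e * (if Disjoint S (N (V e)) then 1 else 0)) = (1 - θ) * ∑ e, y e := by
      rw [Finset.mul_sum]
      refine Finset.sum_congr rfl fun e _ => ?_
      rw [listExp_const_mul, listExp_toList_disjoint]
      change y e * ((1 - θ) / P (N (V e))) * P (N (V e)) = _
      have h0 : P (N (V e)) ≠ 0 := by have := hPe e; intro h; linarith
      field_simp
    have h3 : ∑ t ∈ A, listExp p Finset.univ.toList (fun S => max (Z t S - 1) 0) ≤
        A.card * s := by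
      rw [← nsmul_eq_mul]
      exact Finset.sum_le_card_nsmul _ _ _ fun t _ =>
        listExp_max_sub_one_le hp01 _ _ hs (hZ1 t) (hZv t)
    rw [h2]
    nlinarith
  set y₁ : E → ℝ := fun e => a e * (if Disjoint S (N (V e)) then 1 else 0) with hy₁
  have hy₁0 : ∀ e, 0 ≤ y₁ e := fun e => mul_nonneg (ha0 e).1 (by split_ifs <;> simp)
  have hy₁a : ∀ e, y₁ e ≤ a e := fun e =>
    mul_le_of_le_one_right (ha0 e).1 (by split_ifs <;> simp)
  obtain ⟨y', hy', hload', hval⟩ := exists_le_load_le_one V (x := fun _ => 1) (y := y₁)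
    (fun _ => zero_le_one) hy₁0
  simp only [load, Finset.prod_const_one, mul_one, one_mul] at hload' hval
  refine ⟨Finset.univ.filter fun g => y g ≠ 0 ∧ g ∈ S ∧ Disjoint S ((N (V g)).erase g), y',
    fun e => ⟨(hy' e).1, (hy' e).2.trans ((hy₁a e).trans (ha0 e).2)⟩,
    fun e he => (Finset.mem_filter.1 he).2.1, ?_, ?_, hload', ?_⟩
  · intro e he f hf hef
    simp only [Finset.mem_filter, Finset.mem_univ, true_and] at he hf
    by_contra hd
    exact Finset.disjoint_left.1 hf.2.2 he.2.1
      (Finset.mem_erase.2 ⟨hef, by simp [hN, hd]⟩)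
  · intro e he f hf
    simp only [Finset.mem_filter, Finset.mem_univ, true_and] at hf
    have h1 : y₁ e ≠ 0 := fun h => he (le_antisymm (h ▸ (hy' e).2) (hy' e).1)
    have h2 : Disjoint S (N (V e)) := by
      by_contra hd
      exact h1 (by simp [hy₁, hd])
    by_contra hd
    exact Finset.disjoint_left.1 h2 hf.2.1 (by simp [hN, hd])
  · refine hEG.trans ?_
    have h1 : ((Finset.univ.filter fun g => y g ≠ 0 ∧ g ∈ S ∧
        Disjoint S ((N (V g)).erase g)).card : ℝ) =
        ∑ g with y g ≠ 0, if g ∈ S ∧ Disjoint S ((N (V g)).erase g) then (1 : ℝ) else 0 := by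
      rw [← Finset.filter_filter, Finset.sum_boole]
    rw [h1]
    have h2 : ∑ t, max (∑ e with t ∈ V e, y₁ e - 1) 0 ≤ ∑ t ∈ A, max (Z t S - 1) 0 := by
      rw [← Finset.sum_subset (Finset.subset_univ A)]
      · refine Finset.sum_le_sum fun t _ => max_le_max (sub_le_sub_right
          (Finset.sum_le_sum fun e _ => ?_) 1) le_rfl
        refine mul_le_mul_of_nonneg_left ?_ (ha0 e).1
        by_cases hd : Disjoint S (N (V e))
        · have : Disjoint S (N ((V e).erase t)) := by
            refine Finset.disjoint_of_subset_right ?_ hd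
            intro f hf
            simp only [hN, Finset.mem_filter, Finset.mem_univ, true_and] at hf ⊢
            exact fun h => hf (Finset.disjoint_of_subset_right (Finset.erase_subset _ _) h)
          rw [if_pos hd, if_pos this]
        · rw [if_neg hd]; split_ifs <;> simp
      · intro t _ ht
        have : ∑ e with t ∈ V e, y₁ e = 0 := by
          refine Finset.sum_eq_zero fun e he => ?_
          have : y e = 0 := by
            by_contra h
            exact ht (hA e h (Finset.mem_filter.1 he).2)
          simp [hy₁, ha, this]
        rw [this]; simp
    have h3 := mul_le_mul_of_nonneg_left (hval.trans' (sub_le_sub_left h2 _)) hc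
    simp only [hG]
    linarith

end Nibble

/-- Weighted hypergraphs with edges of size at most three, loads at most one and small codegrees
have a matching of about `c` times their weight. -/
def MatchingRatio (c : ℝ) : Prop :=
  ∀ ε : ℝ, 0 < ε → ∃ η : ℝ, 0 < η ∧ ∀ (T E : Type) [Fintype T] [DecidableEq T] [Fintype E]
    [DecidableEq E] (V : E → Finset T) (A : Finset T) (y : E → ℝ), (∀ e, 0 ≤ y e) →
    (∀ e, (V e).Nonempty ∧ (V e).card ≤ 3) → (∀ e, y e ≠ 0 → V e ⊆ A) →
    (∀ t, ∑ e with t ∈ V e, y e ≤ 1) →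
    (∀ t t', t ≠ t' → ∑ e with t ∈ V e ∧ t' ∈ V e, y e ≤ η) →
    ∃ M : Finset E, (∀ e ∈ M, y e ≠ 0) ∧ (∀ e ∈ M, ∀ f ∈ M, e ≠ f → Disjoint (V e) (V f)) ∧
      c * ∑ e, y e - ε * A.card ≤ M.card

lemma MatchingRatio.zero : MatchingRatio 0 := fun ε hε =>
  ⟨1, one_pos, fun T E _ _ _ _ V A y _ _ _ _ _ => ⟨∅, by simp, by simp, by
    have : 0 ≤ ε * A.card := by positivity
    simpa using this⟩⟩

lemma MatchingRatio.step {c θ : ℝ} (h : MatchingRatio c) (hc : 0 ≤ c) (hc1 : c ≤ 1) (hθ : 0 < θ)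
    (hθ1 : θ ≤ 1 / 6) : MatchingRatio (θ * (1 - 3 * θ) + (1 - θ) * c) := by
  intro ε hε
  obtain ⟨η, hη, H⟩ := h (ε / 2) (by positivity)
  refine ⟨min (η / 2) ((ε / 2) ^ 2 / 36), lt_min (by positivity) (by positivity), ?_⟩
  intro T E _ _ _ _ V A y hy hV hA hload hcod
  obtain ⟨M, y', hy', hM0, hMd, hMy', hload', hval⟩ :=
    exists_nibble_step V A y (s := ε / 2) hθ hθ1
      (le_min (by positivity) (by positivity)) (by positivity)
      (by linarith [min_le_right (η / 2) ((ε / 2) ^ 2 / 36)]) hc hy hV hA hload hcod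
  have hne : ∀ e, y' e ≠ 0 → y e ≠ 0 := fun e he h0 =>
    he (le_antisymm (by have := (hy' e).2; rw [h0] at this; linarith) (hy' e).1)
  obtain ⟨M', hM'0, hM'd, hM'c⟩ := H T E V A y' (fun e => (hy' e).1) hV
    (fun e he => hA e (hne e he)) hload' fun t t' htt' => by
      have h1 := hcod t t' htt'
      have h2 : ∑ e with t ∈ V e ∧ t' ∈ V e, y' e ≤ ∑ e with t ∈ V e ∧ t' ∈ V e, 2 * y e :=
        Finset.sum_le_sum fun e _ => (hy' e).2
      rw [← Finset.mul_sum] at h2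
      linarith [min_le_left (η / 2) ((ε / 2) ^ 2 / 36)]
  have hdisj : Disjoint M M' := by
    rw [Finset.disjoint_left]
    intro e he he'
    have := hMy' e (hM'0 e he') e he
    rw [disjoint_self, Finset.bot_eq_empty] at this
    exact (hV e).1.ne_empty this
  refine ⟨M ∪ M', ?_, ?_, ?_⟩
  · intro e he
    rcases Finset.mem_union.1 he with he | he
    · exact hM0 e he
    · exact hne e (hM'0 e he)
  · intro e he f hf hef
    rcases Finset.mem_union.1 he with he | he <;> rcases Finset.mem_union.1 hf with hf | hf
    · exact hMd e he f hf hef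
    · exact hMy' f (hM'0 f hf) e he
    · exact (hMy' e (hM'0 e he) f hf).symm
    · exact hM'd e he f hf hef
  · rw [Finset.card_union_of_disjoint hdisj]
    push_cast
    have : c * (A.card * (ε / 2)) ≤ 1 * (A.card * (ε / 2)) :=
      mul_le_mul_of_nonneg_right hc1 (by positivity)
    nlinarith

lemma MatchingRatio.of_lt_one {c : ℝ} (hc : c < 1) : MatchingRatio c := by
  obtain ⟨θ, hθ, hθ1, hcθ⟩ : ∃ θ : ℝ, 0 < θ ∧ θ ≤ 1 / 6 ∧ c < 1 - 3 * θ := by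
    refine ⟨min (1 / 6) ((1 - c) / 4), lt_min (by norm_num) (by linarith), min_le_left _ _, ?_⟩
    linarith [min_le_right (1 / 6) ((1 - c) / 4)]
  have hpow : ∀ k : ℕ, 0 ≤ (1 - θ) ^ k ∧ (1 - θ) ^ k ≤ 1 := fun k =>
    ⟨pow_nonneg (by linarith) k, pow_le_one₀ (by linarith) (by linarith)⟩
  have hk : ∀ k : ℕ, MatchingRatio ((1 - 3 * θ) * (1 - (1 - θ) ^ k)) := by
    intro k
    induction k with
    | zero => simpa using MatchingRatio.zero
    | succ k ih =>
      obtain ⟨h0, h1⟩ := hpow k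
      have := ih.step (mul_nonneg (by linarith) (by linarith)) (by nlinarith) hθ hθ1
      convert this using 1
      ring
  have hlim : Filter.Tendsto (fun k : ℕ => (1 - 3 * θ) * (1 - (1 - θ) ^ k)) Filter.atTop
      (nhds ((1 - 3 * θ) * (1 - 0))) :=
    ((tendsto_pow_atTop_nhds_zero_of_lt_one (by linarith) (by linarith)).const_sub 1).const_mul _
  rw [sub_zero, mul_one] at hlim
  obtain ⟨k, hck⟩ := (hlim.eventually (lt_mem_nhds hcθ)).exists
  intro ε hε
  obtain ⟨η, hη, H⟩ := hk k ε hε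
  refine ⟨η, hη, fun T E _ _ _ _ V A y hy hV hA hload hcod => ?_⟩
  obtain ⟨M, h1, h2, h3⟩ := H T E V A y hy hV hA hload hcod
  refine ⟨M, h1, h2, h3.trans' (sub_le_sub_right ?_ _)⟩
  exact mul_le_mul_of_nonneg_right hck.le (Finset.sum_nonneg fun e _ => hy e)

/-- Near-optimal matchings (Kahn), for hypergraphs of rank three. -/
theorem exists_matching_of_codegree_le {ε : ℝ} (hε : 0 < ε) :
    ∃ η : ℝ, 0 < η ∧ ∀ (T E : Type) [Fintype T] [DecidableEq T] [Fintype E]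
    [DecidableEq E] (V : E → Finset T) (A : Finset T) (y : E → ℝ), (∀ e, 0 ≤ y e) →
    (∀ e, (V e).Nonempty ∧ (V e).card ≤ 3) → (∀ e, y e ≠ 0 → V e ⊆ A) →
    (∀ t, ∑ e with t ∈ V e, y e ≤ 1) →
    (∀ t t', t ≠ t' → ∑ e with t ∈ V e ∧ t' ∈ V e, y e ≤ η) →
    ∃ M : Finset E, (∀ e ∈ M, y e ≠ 0) ∧ (∀ e ∈ M, ∀ f ∈ M, e ≠ f → Disjoint (V e) (V f)) ∧
      ∑ e, y e - ε * A.card ≤ M.card := by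
  obtain ⟨η, hη, H⟩ := MatchingRatio.of_lt_one (c := 1 - ε / 2) (by linarith) (ε / 2)
    (by positivity)
  refine ⟨η, hη, fun T E _ _ _ _ V A y hy hV hA hload hcod => ?_⟩
  obtain ⟨M, h1, h2, h3⟩ := H T E V A y hy hV hA hload hcod
  refine ⟨M, h1, h2, h3.trans' ?_⟩
  have h4 : ∑ e, y e ≤ A.card := by
    calc ∑ e, y e = ∑ e with ¬ Disjoint (V e) A, y e := by
          refine (Finset.sum_filter_of_ne fun e _ he => ?_).symm
          obtain ⟨t, ht⟩ := (hV e).1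
          exact Finset.not_disjoint_iff.2 ⟨t, ht, hA e he ht⟩
      _ ≤ ∑ t ∈ A, ∑ e with t ∈ V e, y e := sum_not_disjoint_le V A hy
      _ ≤ A.card • (1 : ℝ) := Finset.sum_le_card_nsmul _ _ _ fun t _ => hload t
      _ = A.card := by simp
  nlinarith

section Merge

variable {T E P : Type*} [DecidableEq T] [Fintype E]

lemma load_mono (V : E → Finset T) {x x' : T → ℝ} {y y' : E → ℝ} (hx : ∀ t, 0 ≤ x t)
    (hxx' : ∀ t, x t ≤ x' t) (hy : ∀ e, 0 ≤ y e) (hyy' : ∀ e, y e ≤ y' e) (t : T) :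
    load V x y t ≤ load V x' y' t :=
  Finset.sum_le_sum fun e _ => mul_le_mul (hyy' e)
    (Finset.prod_le_prod (fun t _ => hx t) fun t _ => hxx' t)
    (Finset.prod_nonneg fun t _ => hx t) ((hy e).trans (hyy' e))

lemma sum_mul_prod_sub_le [Fintype T] (V : E → Finset T) {x x' : T → ℝ} {y : E → ℝ}
    (hx : ∀ t, 0 ≤ x t) (hxx' : ∀ t, x t ≤ x' t) (hy : ∀ e, 0 ≤ y e)
    (hload : ∀ t, load V x' y t ≤ 1) :
    ∑ e, y e * ∏ t ∈ V e, x' t - ∑ t, (x' t - x t) ≤ ∑ e, y e * ∏ t ∈ V e, x t := by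
  set r : T → ℝ := fun t => x t / x' t with hr
  have hr01 : ∀ t, 0 ≤ r t ∧ r t ≤ 1 := fun t =>
    ⟨div_nonneg (hx t) ((hx t).trans (hxx' t)), div_le_one_of_le₀ (hxx' t) ((hx t).trans (hxx' t))⟩
  have hrx : ∀ t, x t = r t * x' t := fun t => by
    simp only [hr]
    by_cases h : x' t = 0
    · have : x t = 0 := le_antisymm (h ▸ hxx' t) (hx t)
      simp [h, this]
    · field_simp
  have h1 : ∑ e, (y e * ∏ t ∈ V e, x' t) * ∑ t ∈ V e, (1 - r t) ≤ ∑ t, (x' t - x t) := by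
    simp_rw [Finset.mul_sum]
    rw [sum_sum_mem_comm]
    refine Finset.sum_le_sum fun t _ => ?_
    have h2 : ∑ e with t ∈ V e, y e * (∏ t ∈ V e, x' t) * (1 - r t) =
        (x' t - x t) * load V x' y t := by
      rw [load, Finset.mul_sum]
      refine Finset.sum_congr rfl fun e he => ?_
      rw [← Finset.mul_prod_erase _ _ (Finset.mem_filter.1 he).2, hrx t]
      ring
    rw [h2]
    exact mul_le_of_le_one_right (sub_nonneg.2 (hxx' t)) (hload t)
  have h3 : ∑ e, y e * ∏ t ∈ V e, x' t - ∑ e, (y e * ∏ t ∈ V e, x' t) * ∑ t ∈ V e, (1 - r t) ≤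
      ∑ e, y e * ∏ t ∈ V e, x t := by
    rw [← Finset.sum_sub_distrib]
    refine Finset.sum_le_sum fun e _ => ?_
    have h4 := one_sub_sum_le_prod_one_sub (V e) (fun t => 1 - r t)
      fun t _ => ⟨by linarith [(hr01 t).2], by linarith [(hr01 t).1]⟩
    simp only [sub_sub_cancel] at h4
    have h5 : ∏ t ∈ V e, x t = (∏ t ∈ V e, r t) * ∏ t ∈ V e, x' t := by
      rw [← Finset.prod_mul_distrib]
      exact Finset.prod_congr rfl fun t _ => hrx t
    have h6 := mul_le_mul_of_nonneg_left h4 (mul_nonneg (hy e)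
      (Finset.prod_nonneg fun t (_ : t ∈ V e) => (hx t).trans (hxx' t)))
    rw [h5]
    nlinarith
  linarith

/-- Rounding a convex combination of `α` and `β` by an independent choice on each part. -/
lemma exists_rounding [Fintype T] [Fintype P] [DecidableEq P] (V : E → Finset T) (π : T → P)
    (α β : T → ℝ) (W A : Finset T) (y : E → ℝ) {q D η s : ℝ} {F : ℕ}
    (hq : 0 ≤ q ∧ q ≤ 1) (hη : 0 ≤ η) (hs : 0 < s) (hsη : 3 * D * (F * η) ≤ s ^ 2)
    (hα : ∀ t, 0 ≤ α t ∧ α t ≤ 1) (hβ : ∀ t, 0 ≤ β t ∧ β t ≤ 1)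
    (hW : ∀ t, α t ≠ β t → t ∈ W) (hA : ∀ t, t ∉ A → α t = 0 ∧ β t = 0)
    (hF : ∀ P, (W.filter fun t => π t = P).card ≤ F)
    (hy : ∀ e, 0 ≤ y e) (hV : ∀ e, (V e).card ≤ 3)
    (hload : ∀ t, load V (fun t => q * α t + (1 - q) * β t) y t ≤ 1)
    (hD : ∀ t, ∑ e with t ∈ V e, y e ≤ D)
    (hcod : ∀ t t', t ≠ t' → ∑ e with t ∈ V e ∧ t' ∈ V e, y e ≤ η) :
    ∃ (S : Finset P) (y' : E → ℝ), (∀ e, 0 ≤ y' e ∧ y' e ≤ y e) ∧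
      (∀ t, load V (fun t => if π t ∈ S then α t else β t) y' t ≤ 1) ∧
      ∑ e, y e * ∏ t ∈ V e, (q * α t + (1 - q) * β t) - W.card * (F * η) - A.card * s ≤
        ∑ e, y' e * ∏ t ∈ V e, (if π t ∈ S then α t else β t) := by
  classical
  set p : P → ℝ := fun _ => q with hp
  have hp01 : ∀ j, 0 ≤ p j ∧ p j ≤ 1 := fun _ => hq
  set x : T → ℝ := fun t => q * α t + (1 - q) * β t with hx
  have hx0 : ∀ t, 0 ≤ x t := fun t =>
    add_nonneg (mul_nonneg hq.1 (hα t).1) (mul_nonneg (sub_nonneg.2 hq.2) (hβ t).1)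
  have hx1 : ∀ t, x t ≤ 1 := fun t => by
    have h1 := mul_le_mul_of_nonneg_left (hα t).2 hq.1
    have h2 := mul_le_mul_of_nonneg_left (hβ t).2 (sub_nonneg.2 hq.2)
    simp only [hx]; linarith
  set X : T → Finset P → ℝ := fun t S => if π t ∈ S then α t else β t with hX
  have hX0 : ∀ t S, 0 ≤ X t S := fun t S => by
    simp only [hX]; split_ifs; exacts [(hα t).1, (hβ t).1]
  have hX1 : ∀ t S, X t S ≤ 1 := fun t S => by
    simp only [hX]; split_ifs; exacts [(hα t).2, (hβ t).2]
  have hXi : ∀ t j S, (t ∉ W ∨ π t ≠ j) → X t (insert j S) = X t S := by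
    rintro t j S (h | h)
    · have : α t = β t := by by_contra h'; exact h (hW t h')
      simp [hX, this]
    · simp [hX, Finset.mem_insert, h]
  have hXE : ∀ t, listExp p Finset.univ.toList (X t) = x t := by
    intro t
    have e : X t = fun S => α t + (β t - α t) * (if Disjoint S {π t} then 1 else 0) := by
      ext S
      by_cases h : π t ∈ S <;> simp [hX, h]
    rw [e, listExp_add, listExp_const, listExp_const_mul, listExp_toList_disjoint]
    simp only [Finset.prod_singleton, hp, hx]
    ring
  -- edges with two vertices in the same part are discarded
  set bad : E → Prop := fun e => ∃ t ∈ V e, ∃ t' ∈ V e, t ≠ t' ∧ t ∈ W ∧ t' ∈ W ∧ π t = π t'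
    with hbad
  set y₀ : E → ℝ := fun e => if bad e then 0 else y e with hy₀
  have hy₀0 : ∀ e, 0 ≤ y₀ e := fun e => by
    simp only [hy₀]; split_ifs; exacts [le_rfl, hy e]
  have hy₀y : ∀ e, y₀ e ≤ y e := fun e => by
    simp only [hy₀]; split_ifs; exacts [hy e, le_rfl]
  have hprodE : ∀ e, ¬ bad e → ∀ Q ⊆ V e,
      listExp p Finset.univ.toList (fun S => ∏ t ∈ Q, X t S) = ∏ t ∈ Q, x t := by
    intro e he Q
    induction Q using Finset.induction_on with
    | empty => intro _; simp [listExp_const]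
    | insert a Q ha ih =>
      intro hQ
      simp only [Finset.prod_insert ha]
      rw [listExp_mul, hXE, ih ((Finset.subset_insert _ _).trans hQ)]
      intro j
      by_cases h : a ∉ W ∨ π a ≠ j
      · left; intro S; exact hXi a j S h
      · right
        push Not at h
        intro S
        refine Finset.prod_congr rfl fun t ht => hXi t j S ?_
        by_contra h'
        push Not at h'
        exact he ⟨a, hQ (Finset.mem_insert_self _ _), t, hQ (Finset.mem_insert_of_mem ht),
          fun h => ha (h ▸ ht), h.1, h'.1, h.2.trans h'.2.symm⟩
  set B : P → Finset T := fun j => W.filter fun t => π t = j with hB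
  set Z : T → Finset P → ℝ := fun t S => load V (fun t => X t S) y₀ t with hZ
  have hZ1 : ∀ t, listExp p Finset.univ.toList (Z t) ≤ 1 := by
    intro t
    simp only [hZ, load]
    rw [listExp_sum]
    refine le_trans (Finset.sum_le_sum fun e _ => ?_) (hload t)
    rw [listExp_const_mul]
    by_cases he : bad e
    · simp only [hy₀, he, if_true, zero_mul]
      exact mul_nonneg (hy e) (Finset.prod_nonneg fun t _ => hx0 t)
    · rw [hprodE e he _ (Finset.erase_subset _ _)]
      exact mul_le_mul_of_nonneg_right (hy₀y e) (Finset.prod_nonneg fun t _ => hx0 t)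
  have hprod01 : ∀ (Q : Finset T) S, 0 ≤ ∏ t ∈ Q, X t S ∧ ∏ t ∈ Q, X t S ≤ 1 := fun Q S =>
    ⟨Finset.prod_nonneg fun t _ => hX0 t S,
      Finset.prod_le_one (fun t _ => hX0 t S) fun t _ => hX1 t S⟩
  have hZv : ∀ t, listExp p Finset.univ.toList (fun S => Z t S ^ 2) -
      listExp p Finset.univ.toList (Z t) ^ 2 ≤ s ^ 2 := by
    intro t
    set b : P → ℝ := fun j => ∑ e with t ∈ V e ∧ ¬ Disjoint (B j) ((V e).erase t), y e with hb
    have hb0 : ∀ j, 0 ≤ b j := fun j => Finset.sum_nonneg fun e _ => hy e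
    have hbF : ∀ j, b j ≤ F * η := fun j =>
      sum_mem_mem_not_disjoint_le V hη hy hcod t (B j) (hF j)
    refine (listExp_sq_sub_le hp01 _ (Z t) b fun j S => ?_).trans ?_
    · simp only [hZ, hb, load]
      rw [← Finset.sum_sub_distrib, ← Finset.filter_filter, Finset.sum_filter (fun e => ¬ _)]
      refine (Finset.abs_sum_le_sum_abs _ _).trans (Finset.sum_le_sum fun e _ => ?_)
      rw [← mul_sub, abs_mul, abs_of_nonneg (hy₀0 e)]
      by_cases hd : Disjoint (B j) ((V e).erase t)
      · have : ∏ t' ∈ (V e).erase t, X t' (insert j S) = ∏ t' ∈ (V e).erase t, X t' S := by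
          refine Finset.prod_congr rfl fun t' ht' => hXi t' j S ?_
          by_contra h
          push Not at h
          exact Finset.disjoint_left.1 hd (Finset.mem_filter.2 h) ht'
        rw [this]
        simp [hd]
      · rw [if_pos hd]
        refine (mul_le_of_le_one_right (hy₀0 e) ?_).trans (hy₀y e)
        rw [abs_le]
        constructor <;>
          linarith [(hprod01 ((V e).erase t) (insert j S)).1,
            (hprod01 ((V e).erase t) (insert j S)).2, (hprod01 ((V e).erase t) S).1,
            (hprod01 ((V e).erase t) S).2]
    · rw [Finset.sum_map_toList]
      have h1 : ∀ j, p j * b j ^ 2 ≤ F * η * b j := fun j => by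
        have k1 : b j ^ 2 ≤ F * η * b j := by nlinarith [hb0 j, hbF j]
        exact (mul_le_of_le_one_left (sq_nonneg _) (hp01 j).2).trans k1
      have h2 : ∑ j, b j ≤ 3 * D := by
        have e1 : ∑ j, b j = ∑ e with t ∈ V e,
            ∑ j with ¬ Disjoint (B j) ((V e).erase t), y e := by
          simp only [hb]
          exact Finset.sum_comm' (by simp [and_comm])
        rw [e1]
        calc ∑ e with t ∈ V e, ∑ j with ¬ Disjoint (B j) ((V e).erase t), y e
            ≤ ∑ e with t ∈ V e, 3 * y e := by
              refine Finset.sum_le_sum fun e _ => ?_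
              rw [Finset.sum_const, nsmul_eq_mul]
              refine mul_le_mul_of_nonneg_right ?_ (hy e)
              have k1 : (Finset.univ.filter fun j => ¬ Disjoint (B j) ((V e).erase t)) ⊆
                  ((V e).erase t).image π := by
                intro j hj
                obtain ⟨w, hw, hwe⟩ := Finset.not_disjoint_iff.1 (Finset.mem_filter.1 hj).2
                exact Finset.mem_image.2 ⟨w, hwe, (Finset.mem_filter.1 hw).2⟩
              have k2 := (Finset.card_le_card k1).trans
                (Finset.card_image_le.trans (Finset.card_erase_le.trans (hV e)))
              exact_mod_cast k2
          _ ≤ 3 * D := by rw [← Finset.mul_sum]; linarith [hD t]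
      calc ∑ j, p j * b j ^ 2 ≤ ∑ j, F * η * b j := Finset.sum_le_sum fun j _ => h1 j
        _ = F * η * ∑ j, b j := by rw [Finset.mul_sum]
        _ ≤ F * η * (3 * D) := mul_le_mul_of_nonneg_left h2 (by positivity)
        _ ≤ s ^ 2 := by linarith
  have hloss : ∑ e, y e * ∏ t ∈ V e, x t - W.card * (F * η) ≤
      ∑ e, y₀ e * ∏ t ∈ V e, x t := by
    have h1 : ∑ e, (y e - y₀ e) ≤ W.card * (F * η) := by
      have h2 : ∑ t ∈ W, ∑ e with t ∈ V e ∧ ¬ Disjoint (B (π t)) ((V e).erase t), y e ≤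
          W.card * (F * η) := by
        rw [← nsmul_eq_mul]
        exact Finset.sum_le_card_nsmul _ _ _ fun t _ =>
          sum_mem_mem_not_disjoint_le V hη hy hcod t _ (hF _)
      refine le_trans ?_ h2
      have h3 : ∑ t ∈ W, ∑ e with t ∈ V e ∧ ¬ Disjoint (B (π t)) ((V e).erase t), y e =
          ∑ e, ∑ t ∈ W with t ∈ V e ∧ ¬ Disjoint (B (π t)) ((V e).erase t), y e :=
        Finset.sum_comm' (by simp)
      rw [h3]
      refine Finset.sum_le_sum fun e _ => ?_
      by_cases he : bad e
      · obtain ⟨t, ht, t', ht', htt', htW, ht'W, hπ⟩ := he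
        refine le_trans (by linarith [hy₀0 e]) (Finset.single_le_sum (f := fun _ => y e)
          (fun _ _ => hy e) (Finset.mem_filter.2 ⟨htW, ht, ?_⟩))
        exact Finset.not_disjoint_iff.2 ⟨t', Finset.mem_filter.2 ⟨ht'W, hπ.symm⟩,
          Finset.mem_erase.2 ⟨htt'.symm, ht'⟩⟩
      · simp only [hy₀, he, if_false, sub_self]
        exact Finset.sum_nonneg fun _ _ => hy e
    have h4 : ∑ e, y e * ∏ t ∈ V e, x t - ∑ e, (y e - y₀ e) ≤ ∑ e, y₀ e * ∏ t ∈ V e, x t := by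
      rw [← Finset.sum_sub_distrib]
      refine Finset.sum_le_sum fun e _ => ?_
      have h5 : ∏ t ∈ V e, x t ≤ 1 := Finset.prod_le_one (fun t _ => hx0 t) fun t _ => hx1 t
      have := mul_le_mul_of_nonneg_left h5 (sub_nonneg.2 (hy₀y e))
      nlinarith
    linarith
  set G : Finset P → ℝ := fun S =>
    ∑ e, y₀ e * ∏ t ∈ V e, X t S + (-1) * ∑ t ∈ A, max (Z t S - 1) 0 with hG
  obtain ⟨S, hS⟩ := exists_listExp_le hp01 Finset.univ.toList G
  have hEG : ∑ e, y e * ∏ t ∈ V e, x t - W.card * (F * η) - A.card * s ≤ G S := by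
    refine le_trans ?_ hS
    simp only [hG]
    rw [listExp_add, listExp_const_mul, listExp_sum, listExp_sum]
    have h1 : ∑ e, listExp p Finset.univ.toList (fun S => y₀ e * ∏ t ∈ V e, X t S) =
        ∑ e, y₀ e * ∏ t ∈ V e, x t := by
      refine Finset.sum_congr rfl fun e _ => ?_
      rw [listExp_const_mul]
      by_cases he : bad e
      · simp [hy₀, he]
      · rw [hprodE e he _ subset_rfl]
    have h3 : ∑ t ∈ A, listExp p Finset.univ.toList (fun S => max (Z t S - 1) 0) ≤
        A.card * s := by
      rw [← nsmul_eq_mul]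
      exact Finset.sum_le_card_nsmul _ _ _ fun t _ =>
        listExp_max_sub_one_le hp01 _ _ hs (hZ1 t) (hZv t)
    rw [h1]
    linarith
  obtain ⟨y', hy', hload', hval⟩ := exists_le_load_le_one V (x := fun t => X t S) (y := y₀)
    (fun t => hX0 t S) hy₀0
  refine ⟨S, y', fun e => ⟨(hy' e).1, (hy' e).2.trans (hy₀y e)⟩, hload', hEG.trans ?_⟩
  refine le_trans ?_ hval
  have h1 : ∑ t, X t S * max (Z t S - 1) 0 ≤ ∑ t ∈ A, max (Z t S - 1) 0 := by
    rw [← Finset.sum_subset (Finset.subset_univ A)]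
    · exact Finset.sum_le_sum fun t _ => mul_le_of_le_one_left (le_max_right _ _) (hX1 t S)
    · intro t _ ht
      simp [hX, hA t ht]
  simp only [hG]
  linarith

end Merge

section Cut

variable {U : Type*} [Fintype U] [DecidableEq U]

lemma exists_separated_hitting (τ : Equiv.Perm U) (L : ℕ) :
    ∃ S : Finset U, (∀ s ∈ S, ∀ i ≤ L, (τ ^ i) s ∈ S → (τ ^ i) s = s) ∧
      ∀ u, ∃ i ≤ 2 * L, (τ ^ i) u ∈ S := by
  classical
  obtain ⟨S, hS, hmax⟩ := Finset.exists_max_image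
    (Finset.univ.filter fun S : Finset U => ∀ s ∈ S, ∀ i ≤ L, (τ ^ i) s ∈ S → (τ ^ i) s = s)
    Finset.card ⟨∅, by simp⟩
  simp only [Finset.mem_filter, Finset.mem_univ, true_and] at hS hmax
  refine ⟨S, hS, fun u => ?_⟩
  by_contra! h
  have hv : (τ ^ L) u ∉ S := h L (by omega)
  have := hmax (insert ((τ ^ L) u) S) ?_
  · rw [Finset.card_insert_of_notMem hv] at this
    omega
  intro s hs i hi hmem
  rcases Finset.mem_insert.1 hs with rfl | hs
  · rcases Finset.mem_insert.1 hmem with h1 | h1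
    · exact h1
    · rw [← Equiv.Perm.mul_apply, ← pow_add] at h1
      exact absurd h1 (h _ (by omega))
  · rcases Finset.mem_insert.1 hmem with h1 | h1
    · have h2 : s = (τ ^ (L - i)) u := by
        apply (τ ^ i).injective
        rw [h1, ← Equiv.Perm.mul_apply, ← pow_add, Nat.add_sub_cancel' hi]
      exact absurd (h2 ▸ hs) (h _ (by omega))
    · exact hS s hs i hi h1

/-- The cycles of a permutation can be cut into short paths by deleting few edges. -/
lemma exists_cut (τ : Equiv.Perm U) (L : ℕ) :
    ∃ ρ : U → U, (∀ r, (Finset.univ.filter fun u => ρ u = r).card ≤ 2 * L + 1) ∧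
      (Finset.univ.filter fun u => ρ (τ u) ≠ ρ u).card * L ≤ Fintype.card U := by
  obtain ⟨S, hsep, hhit⟩ := exists_separated_hitting τ L
  have hex : ∀ u, ∃ i, (τ ^ i) u ∈ S := fun u => (hhit u).imp fun _ h => h.2
  set m : U → ℕ := fun u => Nat.find (hex u) with hm
  have hmS : ∀ u, (τ ^ m u) u ∈ S := fun u => Nat.find_spec (hex u)
  have hmin : ∀ u i, (τ ^ i) u ∈ S → m u ≤ i := fun u i h => Nat.find_min' (hex u) h
  have hm2 : ∀ u, m u ≤ 2 * L := fun u => by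
    obtain ⟨i, hi, h⟩ := hhit u
    exact (hmin u i h).trans hi
  have hstep : ∀ u i, (τ ^ (i + 1)) u = (τ ^ i) (τ u) := fun u i => by
    rw [pow_succ, Equiv.Perm.mul_apply]
  refine ⟨fun u => (τ ^ m u) u, fun r => ?_, ?_⟩
  · calc _ ≤ (Finset.range (2 * L + 1)).card := by
          refine Finset.card_le_card_of_injOn m (fun u _ => ?_) fun u hu v hv huv => ?_
          · have := hm2 u
            simp only [Finset.coe_range, Set.mem_Iio]
            omega
          · simp only [Finset.coe_filter, Finset.mem_univ, true_and, Set.mem_ofPred_eq] at hu hv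
            rw [← hv, huv] at hu
            exact (τ ^ m v).injective hu
      _ = _ := Finset.card_range _
  · set B := Finset.univ.filter fun u => (τ ^ m (τ u)) (τ u) ≠ (τ ^ m u) u with hB
    have hBS : ∀ u ∈ B, u ∈ S := fun u hu => by
      by_contra hu'
      simp only [hB, Finset.mem_filter, Finset.mem_univ, true_and] at hu
      have h0 : m u ≠ 0 := fun h => hu' (by simpa [h] using hmS u)
      obtain ⟨k, hk⟩ := Nat.exists_eq_succ_of_ne_zero h0
      have h1 := hmS u
      rw [hk, hstep] at h1
      have h2 := hmin _ _ h1
      have h3 := hmS (τ u)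
      rw [← hstep] at h3
      have h4 := hmin _ _ h3
      have h5 : m u = m (τ u) + 1 := by omega
      exact hu (by rw [h5, hstep])
    have hBn : ∀ u ∈ B, ∀ j < L, (τ ^ (j + 1)) u ∉ S := fun u hu j hj hmem => by
      have huS := hBS u hu
      simp only [hB, Finset.mem_filter, Finset.mem_univ, true_and] at hu
      have h0 : m u = 0 := Nat.le_zero.1 (hmin u 0 (by simpa using huS))
      rw [hstep] at hmem
      have h1 := hmin _ _ hmem
      apply hu
      rw [← hstep, h0, pow_zero, Equiv.Perm.one_apply]
      refine hsep u huS _ (by omega) ?_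
      rw [hstep]
      exact hmS _
    have key : ∀ u ∈ B, ∀ v ∈ B, ∀ j < L, ∀ k < L, j ≤ k →
        (τ ^ (j + 1)) u = (τ ^ (k + 1)) v → u = v ∧ j = k := fun u hu v hv j hj k hk hjk h => by
      obtain ⟨d, rfl⟩ := Nat.exists_eq_add_of_le hjk
      have h1 : u = (τ ^ d) v := by
        apply (τ ^ (j + 1)).injective
        rw [h, ← Equiv.Perm.mul_apply, ← pow_add]
        congr 2
        omega
      rcases d with _ | d
      · exact ⟨by simpa using h1, rfl⟩
      · exact absurd (h1 ▸ hBS u hu) (hBn v hv d (by omega))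
    calc B.card * L = (B ×ˢ Finset.range L).card := by simp
      _ ≤ (Finset.univ : Finset U).card := by
          refine Finset.card_le_card_of_injOn (fun p => (τ ^ (p.2 + 1)) p.1)
            (fun _ _ => Finset.mem_coe.2 (Finset.mem_univ _)) ?_
          rintro ⟨u, j⟩ hp ⟨v, k⟩ hq h
          simp only [Finset.coe_product, Set.mem_prod, Finset.mem_coe, Finset.mem_range] at hp hq h
          rcases le_total j k with hjk | hjk
          · obtain ⟨h1, h2⟩ := key u hp.1 v hq.1 j hp.2 k hq.2 hjk h
            rw [h1, h2]
          · obtain ⟨h1, h2⟩ := key v hq.1 u hp.1 k hq.2 j hp.2 hjk h.symm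
            rw [h1, h2]
      _ = _ := Finset.card_univ

end Cut

section PartialPerm

variable {U : Type*}

/-- A set of positions of a square array, no two in a common row or column. -/
def IsPartialPerm (ω : Finset (U × U)) : Prop :=
  ∀ s ∈ ω, ∀ t ∈ ω, s.1 = t.1 ∨ s.2 = t.2 → s = t

lemma IsPartialPerm.mono {ω ω' : Finset (U × U)} (h : IsPartialPerm ω) (h' : ω' ⊆ ω) :
    IsPartialPerm ω' :=
  fun s hs t ht => h s (h' hs) t (h' ht)

lemma IsPartialPerm.card_le [Fintype U] {ω : Finset (U × U)} (h : IsPartialPerm ω) :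
    ω.card ≤ Fintype.card U :=
  Finset.card_le_card_of_injOn Prod.fst (fun _ _ => Finset.mem_coe.2 (Finset.mem_univ _))
    fun s hs t ht hst => h s hs t ht (Or.inl hst)

variable [Fintype U] [DecidableEq U]

lemma IsPartialPerm.exists_perm {ω : Finset (U × U)} (h : IsPartialPerm ω) :
    ∃ σ : Equiv.Perm U, ∀ t ∈ ω, σ t.1 = t.2 := by
  classical
  have hex : ∀ u : U, ∃ v, u ∈ ω.image Prod.fst → (u, v) ∈ ω := fun u => by
    by_cases hu : u ∈ ω.image Prod.fst
    · obtain ⟨t, ht, rfl⟩ := Finset.mem_image.1 hu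
      exact ⟨t.2, fun _ => ht⟩
    · exact ⟨u, fun h => absurd h hu⟩
  choose f hf using hex
  obtain ⟨g, hg⟩ := Finset.exists_equiv_extend_of_card_eq (t := (Finset.univ : Finset U))
    Finset.card_univ.symm (s := ω.image Prod.fst) (f := f) (Finset.subset_univ _)
    (fun u hu v hv huv => by
      have h1 := h _ (hf u hu) _ (hf v hv) (Or.inr huv)
      exact congrArg Prod.fst h1)
  refine ⟨g.trans (Equiv.subtypeUnivEquiv Finset.mem_univ), fun t ht => ?_⟩
  have h1 : t.1 ∈ ω.image Prod.fst := Finset.mem_image_of_mem _ ht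
  have h2 := h _ (hf t.1 h1) _ ht (Or.inl rfl)
  have h3 : f t.1 = t.2 := congrArg Prod.snd h2
  rw [← h3, ← hg t.1 h1]
  rfl

/-- Row and column classes of bounded size such that `ω₂` only uses positions in matching classes,
and `ω₁` mostly does. -/
lemma exists_classes {ω₁ ω₂ : Finset (U × U)} (h₁ : IsPartialPerm ω₁) (h₂ : IsPartialPerm ω₂)
    (L : ℕ) : ∃ ρ γ : U → U,
      (∀ r, (Finset.univ.filter fun u => ρ u = r).card ≤ 2 * L + 1) ∧
      (∀ t ∈ ω₂, ρ t.1 = γ t.2) ∧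
      (ω₁.filter fun t => ρ t.1 ≠ γ t.2).card * L ≤ Fintype.card U := by
  obtain ⟨σ₁, hσ₁⟩ := h₁.exists_perm
  obtain ⟨σ₂, hσ₂⟩ := h₂.exists_perm
  obtain ⟨ρ, h1, h2⟩ := exists_cut (σ₁.trans σ₂.symm) L
  refine ⟨ρ, fun v => ρ (σ₂.symm v), h1, fun t ht => by simp [← hσ₂ t ht], h2.trans' ?_⟩
  refine Nat.mul_le_mul_right _ (Finset.card_le_card_of_injOn Prod.fst (fun t ht => ?_)
    fun s hs t ht hst => ?_)
  · simp only [Finset.coe_filter, Set.mem_ofPred_eq] at ht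
    refine Finset.mem_coe.2 (Finset.mem_filter.2 ⟨Finset.mem_univ _, ?_⟩)
    rw [Equiv.trans_apply, hσ₁ t ht.1]
    exact ht.2.symm
  · simp only [Finset.coe_filter, Set.mem_ofPred_eq] at hs ht
    exact h₁ s hs.1 t ht.1 (Or.inl hst)

end PartialPerm

section Mixture

variable {U : Type*} [Fintype U] [DecidableEq U]

/-- The weight that a weighted list of sets of positions puts on a position. -/
def mixture (Λ : List (ℝ × Finset (U × U))) (t : U × U) : ℝ :=
  (Λ.map fun p => if t ∈ p.2 then p.1 else 0).sum

omit [Fintype U] in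
lemma mixture_cons (p : ℝ × Finset (U × U)) (Λ : List (ℝ × Finset (U × U))) (t : U × U) :
    mixture (p :: Λ) t = (if t ∈ p.2 then p.1 else 0) + mixture Λ t := by
  simp [mixture]

omit [Fintype U] in
lemma mixture_nonneg {Λ : List (ℝ × Finset (U × U))} (hΛ : ∀ p ∈ Λ, 0 < p.1) (t : U × U) :
    0 ≤ mixture Λ t := by
  refine List.sum_nonneg fun a ha => ?_
  obtain ⟨p, hp, rfl⟩ := List.mem_map.1 ha
  split_ifs
  exacts [(hΛ p hp).le, le_rfl]

omit [Fintype U] in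
lemma mixture_le {Λ : List (ℝ × Finset (U × U))} (hΛ : ∀ p ∈ Λ, 0 < p.1) (t : U × U) :
    mixture Λ t ≤ (Λ.map Prod.fst).sum := by
  refine List.sum_le_sum fun p hp => ?_
  split_ifs
  exacts [le_rfl, (hΛ p hp).le]

lemma card_mixture_ne_zero_le {Λ : List (ℝ × Finset (U × U))} (hΛ : ∀ p ∈ Λ, IsPartialPerm p.2) :
    (Finset.univ.filter fun t => mixture Λ t ≠ 0).card ≤ Λ.length * Fintype.card U := by
  induction Λ with
  | nil => simp [mixture]
  | cons p Λ ih =>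
    have h1 := ih fun q hq => hΛ q (List.mem_cons_of_mem _ hq)
    have h2 := (hΛ p List.mem_cons_self).card_le
    have h3 : (Finset.univ.filter fun t => mixture (p :: Λ) t ≠ 0) ⊆
        p.2 ∪ Finset.univ.filter fun t => mixture Λ t ≠ 0 := fun t ht => by
      simp only [Finset.mem_filter, Finset.mem_univ, true_and, Finset.mem_union,
        mixture_cons] at ht ⊢
      by_contra! h
      simp [h.1, h.2] at ht
    calc _ ≤ _ := Finset.card_le_card h3
      _ ≤ _ := Finset.card_union_le _ _
      _ ≤ _ := by rw [List.length_cons, add_mul, one_mul]; omega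

end Mixture

/-- Fractional matchings of bounded degree and codegree at most `η`, with respect to a mixture of
`k + 1` partial permutations, can be rounded with loss at most `ε` times the number of rows. -/
def RoundsMixtures (k : ℕ) (D ε η : ℝ) : Prop :=
  ∀ (U E : Type) [Fintype U] [DecidableEq U]
    [Fintype E] [DecidableEq E] (V : E → Finset (U × U)) (y : E → ℝ)
    (Λ : List (ℝ × Finset (U × U))), Λ.length = k + 1 →
    (∀ p ∈ Λ, 0 < p.1) → (∀ p ∈ Λ, IsPartialPerm p.2) → (Λ.map Prod.fst).sum = 1 →
    (∀ e, 0 ≤ y e) → (∀ e, (V e).Nonempty ∧ (V e).card ≤ 3) →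
    (∀ t, load V (mixture Λ) y t ≤ 1) →
    (∀ t, ∑ e with t ∈ V e, y e ≤ D) →
    (∀ t t', t ≠ t' → ∑ e with t ∈ V e ∧ t' ∈ V e, y e ≤ η) →
    ∃ (ω : Finset (U × U)) (M : Finset E), IsPartialPerm ω ∧
      (∀ e ∈ M, y e ≠ 0 ∧ V e ⊆ ω) ∧
      (∀ e ∈ M, ∀ f ∈ M, e ≠ f → Disjoint (V e) (V f)) ∧
      ∑ e, y e * ∏ t ∈ V e, mixture Λ t - ε * Fintype.card U ≤ M.card

lemma exists_roundsMixtures_zero (D : ℝ) {ε : ℝ} (hε : 0 < ε) :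
    ∃ η : ℝ, 0 < η ∧ RoundsMixtures 0 D ε η := by
  obtain ⟨η, hη, H⟩ := exists_matching_of_codegree_le hε
  refine ⟨η, hη, fun U E _ _ _ _ V y Λ hlen hpos hperm hsum hy hV hload _ hcod => ?_⟩
  obtain ⟨⟨l, ω⟩, rfl⟩ := List.length_eq_one_iff.1 hlen
  have hl : l = 1 := by simpa using hsum
  subst hl
  have hω : IsPartialPerm ω := hperm _ List.mem_cons_self
  have hx : ∀ t, mixture [((1 : ℝ), ω)] t = if t ∈ ω then 1 else 0 := fun t => by simp [mixture]
  set x := mixture [((1 : ℝ), ω)] with hxdef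
  have hx0 : ∀ t, 0 ≤ x t := mixture_nonneg hpos
  have hx1 : ∀ t, x t ≤ 1 := fun t => (mixture_le hpos t).trans_eq hsum
  have hle : ∀ e, y e * ∏ t ∈ V e, x t ≤ y e := fun e =>
    mul_le_of_le_one_right (hy e) (Finset.prod_le_one (fun t _ => hx0 t) fun t _ => hx1 t)
  have hne : ∀ e, y e * ∏ t ∈ V e, x t ≠ 0 → y e ≠ 0 ∧ V e ⊆ ω := fun e he => by
    refine ⟨left_ne_zero_of_mul he, fun t ht => ?_⟩
    have := Finset.prod_ne_zero_iff.1 (right_ne_zero_of_mul he) t ht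
    rw [hx] at this
    simpa using this
  have hload' : ∀ t, ∑ e with t ∈ V e, y e * ∏ t ∈ V e, x t ≤ 1 := fun t => by
    refine (Finset.sum_le_sum fun e he => ?_).trans (hload t)
    have ht := (Finset.mem_filter.1 he).2
    rw [← Finset.mul_prod_erase _ _ ht]
    refine mul_le_mul_of_nonneg_left ?_ (hy e)
    exact mul_le_of_le_one_left (Finset.prod_nonneg fun t _ => hx0 t) (hx1 t)
  obtain ⟨M, h1, h2, h3⟩ := H (U × U) E V ω (fun e => y e * ∏ t ∈ V e, x t)
    (fun e => mul_nonneg (hy e) (Finset.prod_nonneg fun t _ => hx0 t)) hV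
    (fun e he => (hne e he).2)
    hload'
    (fun t t' htt' => (Finset.sum_le_sum fun e _ => hle e).trans (hcod t t' htt'))
  refine ⟨ω, M, hω, fun e he => hne e (h1 e he), h2, h3.trans' ?_⟩
  have : (ω.card : ℝ) ≤ Fintype.card U := by exact_mod_cast hω.card_le
  gcongr

lemma IsPartialPerm.merge {U P : Type*} [DecidableEq U] [DecidableEq P] {ω₁ ω₂ : Finset (U × U)}
    (h₁ : IsPartialPerm ω₁) (h₂ : IsPartialPerm ω₂) (ρ γ : U → P) (hρ₁ : ∀ t ∈ ω₁, ρ t.1 = γ t.2)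
    (hρ₂ : ∀ t ∈ ω₂, ρ t.1 = γ t.2) (S : Finset P) :
    IsPartialPerm ((ω₁.filter fun t => ρ t.1 ∈ S) ∪ ω₂.filter fun t => ρ t.1 ∉ S) := by
  intro s hs t ht hst
  simp only [Finset.mem_union, Finset.mem_filter] at hs ht
  have hiff : ρ s.1 = ρ t.1 := by
    rcases hst with h | h
    · rw [h]
    · have hs' : ρ s.1 = γ s.2 := hs.elim (fun h => hρ₁ s h.1) fun h => hρ₂ s h.1
      have ht' : ρ t.1 = γ t.2 := ht.elim (fun h => hρ₁ t h.1) fun h => hρ₂ t h.1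
      rw [hs', ht', h]
  rw [hiff] at hs
  by_cases hS : ρ t.1 ∈ S
  · exact h₁ s (by tauto) t (by tauto) hst
  · exact h₂ s (by tauto) t (by tauto) hst

lemma IsPartialPerm.card_filter_class_le {U P : Type*} [Fintype U] [DecidableEq P]
    {ω : Finset (U × U)} (h : IsPartialPerm ω) {ρ : U → P} {m : ℕ}
    (hρ : ∀ r, (Finset.univ.filter fun u => ρ u = r).card ≤ m) (r : P) :
    (ω.filter fun t => ρ t.1 = r).card ≤ m := by
  refine (hρ r).trans' (Finset.card_le_card_of_injOn Prod.fst (fun t ht => ?_)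
    fun s hs t ht hst => h s (Finset.mem_filter.1 hs).1 t (Finset.mem_filter.1 ht).1 (Or.inl hst))
  exact Finset.mem_coe.2
    (Finset.mem_filter.2 ⟨Finset.mem_univ _, (Finset.mem_filter.1 (Finset.mem_coe.1 ht)).2⟩)

lemma exists_roundsMixtures_succ {k : ℕ} {D ε : ℝ} (hD : 0 < D) (hε : 0 < ε)
    (hk : ∃ η : ℝ, 0 < η ∧ RoundsMixtures k D (ε / 2) η) :
    ∃ η : ℝ, 0 < η ∧ RoundsMixtures (k + 1) D ε η := by
  obtain ⟨η₀, hη₀, H⟩ := hk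
  obtain ⟨L, hL⟩ := exists_nat_gt (4 / ε)
  have hL0 : (0 : ℝ) < L := (by positivity : 0 < 4 / ε).trans hL
  set F : ℕ := 2 * (2 * L + 1) with hF
  have hF0 : (0 : ℝ) < F := by exact_mod_cast (by omega : 0 < F)
  set s : ℝ := ε / (8 * (k + 3)) with hs
  have hs0 : 0 < s := by positivity
  set η : ℝ := min η₀ (min (ε / (16 * F)) (s ^ 2 / (3 * D * F))) with hη
  have hη0 : 0 < η := lt_min hη₀ (lt_min (by positivity) (by positivity))
  refine ⟨η, hη0, fun U E _ _ _ _ V y Λ hlen hpos hperm hsum hy hV hload hdeg hcod => ?_⟩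
  have hη1 : η ≤ η₀ := min_le_left _ _
  have hη2 : F * η ≤ ε / 16 := by
    have := (min_le_right η₀ _).trans (min_le_left (ε / (16 * F)) (s ^ 2 / (3 * D * F)))
    rw [← hη, le_div_iff₀ (by positivity)] at this
    linarith
  have hη3 : 3 * D * (F * η) ≤ s ^ 2 := by
    have := (min_le_right η₀ _).trans (min_le_right (ε / (16 * F)) (s ^ 2 / (3 * D * F)))
    rw [← hη, le_div_iff₀ (by positivity)] at this
    linarith
  obtain ⟨⟨l₁, ω₁⟩, Λ₁, rfl⟩ := List.exists_cons_of_length_eq_add_one hlen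
  obtain ⟨⟨l₂, ω₂⟩, R, rfl⟩ := List.exists_cons_of_length_eq_add_one
    (by simpa using hlen : Λ₁.length = k + 1)
  have hRlen : R.length = k := by simpa using hlen
  simp only [List.forall_mem_cons] at hpos hperm
  simp only [List.map_cons, List.sum_cons] at hsum
  obtain ⟨hl₁, hl₂, hR⟩ := hpos
  obtain ⟨hω₁, hω₂, hRp⟩ := hperm
  obtain ⟨ρ, γ, hρ, hρ₂, hbad⟩ := exists_classes hω₁ hω₂ L
  set ω₁' := ω₁.filter fun t => ρ t.1 = γ t.2 with hω₁'
  have hω₁'p : IsPartialPerm ω₁' := hω₁.mono (Finset.filter_subset _ _)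
  set r := mixture R with hr
  set x := mixture ((l₁, ω₁) :: (l₂, ω₂) :: R) with hx
  have hxt : ∀ t, x t = (if t ∈ ω₁ then l₁ else 0) + ((if t ∈ ω₂ then l₂ else 0) + r t) :=
    fun t => by simp only [hx, mixture_cons, hr]
  have hr0 : ∀ t, 0 ≤ r t := mixture_nonneg hR
  have hr1 : ∀ t, r t ≤ 1 - (l₁ + l₂) := fun t => by
    have := mixture_le hR t
    linarith
  set x' : U × U → ℝ := fun t =>
    (if t ∈ ω₁' then l₁ else 0) + ((if t ∈ ω₂ then l₂ else 0) + r t) with hx'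
  have hx'0 : ∀ t, 0 ≤ x' t := fun t => by
    have := hr0 t
    simp only [hx']
    split_ifs <;> linarith
  have hdiff : ∀ t, x t - x' t = if t ∈ ω₁.filter (fun t => ρ t.1 ≠ γ t.2) then l₁ else 0 :=
    fun t => by
      simp only [hxt, hx', hω₁', Finset.mem_filter]
      by_cases h1 : t ∈ ω₁ <;> by_cases h2 : ρ t.1 = γ t.2 <;> simp [h1, h2]
  have hxx' : ∀ t, x' t ≤ x t := fun t => by
    have := hdiff t
    split_ifs at this <;> linarith
  have hloss := sum_mul_prod_sub_le V hx'0 hxx' hy hload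
  have hN : (0 : ℝ) ≤ Fintype.card U := Nat.cast_nonneg _
  have hloss2 : ∑ t, (x t - x' t) ≤ ε / 4 * Fintype.card U := by
    simp only [hdiff]
    rw [Finset.sum_ite_mem, Finset.univ_inter, Finset.sum_const, nsmul_eq_mul]
    have h1 : ((ω₁.filter fun t => ρ t.1 ≠ γ t.2).card : ℝ) * L ≤ Fintype.card U := by
      exact_mod_cast hbad
    have h2 : l₁ ≤ 1 := by
      have : 0 ≤ (R.map Prod.fst).sum := List.sum_nonneg fun a ha => by
        obtain ⟨p, hp, rfl⟩ := List.mem_map.1 ha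
        exact (hR p hp).le
      linarith
    have h3 : 1 ≤ ε / 4 * L := by
      rw [div_lt_iff₀ hε] at hL
      linarith
    set b : ℝ := ((ω₁.filter fun t => ρ t.1 ≠ γ t.2).card : ℝ)
    have hb : 0 ≤ b := Nat.cast_nonneg _
    calc b * l₁ ≤ b * 1 := by gcongr
      _ ≤ b * (ε / 4 * L) := by gcongr
      _ = ε / 4 * (b * L) := by ring
      _ ≤ _ := by gcongr
  set μ := l₁ + l₂ with hμ
  have hμ0 : 0 < μ := by positivity
  set α : U × U → ℝ := fun t => (if t ∈ ω₁' then μ else 0) + r t with hα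
  set β : U × U → ℝ := fun t => (if t ∈ ω₂ then μ else 0) + r t with hβ
  have hq : (fun t => l₁ / μ * α t + (1 - l₁ / μ) * β t) = x' := by
    funext t
    have h1 : 1 - l₁ / μ = l₂ / μ := by
      rw [eq_div_iff hμ0.ne', sub_mul, div_mul_cancel₀ _ hμ0.ne']
      linarith
    have h2 : l₁ / μ * μ = l₁ := div_mul_cancel₀ _ hμ0.ne'
    have h3 : l₂ / μ * μ = l₂ := div_mul_cancel₀ _ hμ0.ne'
    have h4 : l₁ / μ + l₂ / μ = 1 := by rw [← h1]; ring
    have h5 : l₁ / μ * r t + l₂ / μ * r t = r t := by rw [← add_mul, h4, one_mul]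
    simp only [h1, hα, hβ, hx', mul_add]
    split_ifs <;> simp only [h2, h3, mul_zero] <;> linarith
  set A := ω₁' ∪ ω₂ ∪ Finset.univ.filter fun t => r t ≠ 0 with hA
  have hcard₁ : (ω₁'.card : ℝ) ≤ Fintype.card U := by exact_mod_cast hω₁'p.card_le
  have hcard₂ : (ω₂.card : ℝ) ≤ Fintype.card U := by exact_mod_cast hω₂.card_le
  have hWc : ((ω₁' ∪ ω₂).card : ℝ) ≤ 2 * Fintype.card U := by
    have : ((ω₁' ∪ ω₂).card : ℝ) ≤ ω₁'.card + ω₂.card := by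
      exact_mod_cast Finset.card_union_le _ _
    linarith
  have hAc : (A.card : ℝ) ≤ (k + 2) * Fintype.card U := by
    have h1 : (A.card : ℝ) ≤ (ω₁' ∪ ω₂).card + (Finset.univ.filter fun t => r t ≠ 0).card := by
      exact_mod_cast Finset.card_union_le _ _
    have h2 : ((Finset.univ.filter fun t => r t ≠ 0).card : ℝ) ≤ k * Fintype.card U := by
      have := card_mixture_ne_zero_le hRp
      rw [hRlen] at this
      exact_mod_cast this
    linarith
  obtain ⟨S, y', hy', hload', hsum'⟩ := exists_rounding V (fun t => ρ t.1) α β (ω₁' ∪ ω₂) A y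
    (q := l₁ / μ) (D := D) (η := η) (s := s) (F := F)
    ⟨by positivity, div_le_one_of_le₀ (by linarith) hμ0.le⟩ hη0.le hs0 hη3
    (fun t => by
      have h0 := hr0 t
      have h1 := hr1 t
      simp only [hα]
      constructor <;> split_ifs <;> linarith)
    (fun t => by
      have h0 := hr0 t
      have h1 := hr1 t
      simp only [hβ]
      constructor <;> split_ifs <;> linarith)
    (fun t ht => by
      by_contra h
      simp only [Finset.mem_union, not_or] at h
      simp [hα, hβ, h.1, h.2] at ht)
    (fun t ht => by
      simp only [hA, Finset.mem_union, Finset.mem_filter, Finset.mem_univ, true_and, not_or,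
        not_not] at ht
      simp [hα, hβ, ht.1.1, ht.1.2, ht.2])
    (fun j => by
      rw [Finset.filter_union]
      have h1 := hω₁'p.card_filter_class_le hρ j
      have h2 := hω₂.card_filter_class_le hρ j
      exact (Finset.card_union_le _ _).trans (by omega))
    hy (fun e => (hV e).2)
    (fun t => by
      rw [hq]
      exact (load_mono V hx'0 hxx' hy (fun _ => le_rfl) t).trans (hload t))
    hdeg hcod
  set ω' := (ω₁'.filter fun t => ρ t.1 ∈ S) ∪ ω₂.filter fun t => ρ t.1 ∉ S with hω'
  have hω'p : IsPartialPerm ω' :=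
    hω₁'p.merge hω₂ ρ γ (fun t ht => (Finset.mem_filter.1 ht).2) hρ₂ S
  have hmix : (fun t => if ρ t.1 ∈ S then α t else β t) = mixture ((μ, ω') :: R) := by
    funext t
    rw [mixture_cons]
    simp only [hα, hβ, hω', Finset.mem_union, Finset.mem_filter]
    by_cases h : ρ t.1 ∈ S <;> simp [h, hr]
  simp only [hmix] at hload'
  have hmix' : ∀ e, ∏ t ∈ V e, (if ρ t.1 ∈ S then α t else β t) =
      ∏ t ∈ V e, mixture ((μ, ω') :: R) t := fun e =>
    Finset.prod_congr rfl fun t _ => congrFun hmix t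
  have hq' : ∀ e, ∏ t ∈ V e, (l₁ / μ * α t + (1 - l₁ / μ) * β t) = ∏ t ∈ V e, x' t := fun e =>
    Finset.prod_congr rfl fun t _ => congrFun hq t
  simp only [hmix', hq'] at hsum'
  obtain ⟨ω, M, h1, h2, h3, h4⟩ := H U E V y' ((μ, ω') :: R) (by simp [hRlen])
    (List.forall_mem_cons.2 ⟨hμ0, hR⟩) (List.forall_mem_cons.2 ⟨hω'p, hRp⟩)
    (by simp only [List.map_cons, List.sum_cons]; linarith) (fun e => (hy' e).1) hV hload'
    (fun t => (Finset.sum_le_sum fun e _ => (hy' e).2).trans (hdeg t))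
    (fun t t' htt' => (Finset.sum_le_sum fun e _ => (hy' e).2).trans
      ((hcod t t' htt').trans hη1))
  refine ⟨ω, M, h1, fun e he => ⟨fun h0 => (h2 e he).1 ?_, (h2 e he).2⟩, h3, h4.trans' ?_⟩
  · exact le_antisymm ((hy' e).2.trans_eq h0) (hy' e).1
  · have h5 : ((ω₁' ∪ ω₂).card : ℝ) * (F * η) ≤ ε / 8 * Fintype.card U := by
      calc _ ≤ 2 * Fintype.card U * (ε / 16) := by gcongr
        _ = _ := by ring
    have h6 : (A.card : ℝ) * s ≤ ε / 8 * Fintype.card U := by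
      have h7 : (k + 2) * s ≤ ε / 8 := by
        rw [hs, ← mul_div_assoc, div_le_div_iff₀ (by positivity) (by positivity)]
        nlinarith
      calc _ ≤ (k + 2) * Fintype.card U * s := by gcongr
        _ = (k + 2) * s * Fintype.card U := by ring
        _ ≤ _ := by gcongr
    linarith

theorem exists_roundsMixtures (k : ℕ) {D ε : ℝ} (hD : 0 < D) (hε : 0 < ε) :
    ∃ η : ℝ, 0 < η ∧ RoundsMixtures k D ε η := by
  induction k generalizing ε with
  | zero => exact exists_roundsMixtures_zero D hε
  | succ k ih => exact exists_roundsMixtures_succ hD hε (ih (half_pos hε))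

section Decomposition

variable {U : Type*} [Fintype U] [DecidableEq U]

lemma exists_perm_ne_zero {K : ℕ} (hK : 0 < K) {M : U → U → ℕ} (hrow : ∀ u, ∑ v, M u v = K)
    (hcol : ∀ v, ∑ u, M u v = K) : ∃ σ : Equiv.Perm U, ∀ u, M u (σ u) ≠ 0 := by
  classical
  obtain ⟨f, hf, hfM⟩ := (Finset.all_card_le_biUnion_card_iff_exists_injective
    fun u => Finset.univ.filter fun v => M u v ≠ 0).1 fun s => by
      refine Nat.le_of_mul_le_mul_right ?_ hK
      set N := s.biUnion fun u => Finset.univ.filter fun v => M u v ≠ 0 with hN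
      calc s.card * K = ∑ u ∈ s, ∑ v, M u v := by simp [hrow]
        _ = ∑ u ∈ s, ∑ v ∈ N, M u v := Finset.sum_congr rfl fun u hu => by
            refine (Finset.sum_subset (Finset.subset_univ _) fun v _ hv => ?_).symm
            by_contra h
            exact hv (Finset.mem_biUnion.2
              ⟨u, hu, Finset.mem_filter.2 ⟨Finset.mem_univ _, h⟩⟩)
        _ = ∑ v ∈ N, ∑ u ∈ s, M u v := Finset.sum_comm
        _ ≤ ∑ v ∈ N, ∑ u, M u v := Finset.sum_le_sum fun v _ =>
            Finset.sum_le_sum_of_subset (Finset.subset_univ _)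
        _ = N.card * K := by simp [hcol]
  exact ⟨Equiv.ofBijective f (Finite.injective_iff_bijective.1 hf), fun u =>
    (Finset.mem_filter.1 (hfM u)).2⟩

/-- A nonnegative integer matrix with constant line sums is a sum of permutation matrices. -/
lemma exists_list_perm (K : ℕ) {M : U → U → ℕ} (hrow : ∀ u, ∑ v, M u v = K)
    (hcol : ∀ v, ∑ u, M u v = K) : ∃ l : List (Equiv.Perm U), l.length = K ∧
      ∀ u v, (l.map fun σ => if σ u = v then 1 else 0).sum = M u v := by
  induction K generalizing M with
  | zero =>
    refine ⟨[], rfl, fun u v => ?_⟩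
    have := (Finset.sum_eq_zero_iff.1 (hrow u)) v (Finset.mem_univ _)
    simp [this]
  | succ K ih =>
    obtain ⟨σ, hσ⟩ := exists_perm_ne_zero K.succ_pos hrow hcol
    set M' : U → U → ℕ := fun u v => M u v - if σ u = v then 1 else 0 with hM'
    have hM : ∀ u v, M u v = M' u v + if σ u = v then 1 else 0 := fun u v => by
      simp only [hM']
      split_ifs with h
      · have := hσ u
        rw [h] at this
        omega
      · omega
    have h1 : ∀ u, ∑ v, M' u v = K := fun u => by
      have := hrow u
      simp only [hM, Finset.sum_add_distrib] at this
      rw [Finset.sum_ite_eq] at this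
      simpa using this
    have h2 : ∀ v, ∑ u, M' u v = K := fun v => by
      have := hcol v
      simp only [hM, Finset.sum_add_distrib, ← Equiv.eq_symm_apply] at this
      rw [Finset.sum_ite_eq'] at this
      simpa using this
    obtain ⟨l, hl, hlM⟩ := ih h1 h2
    exact ⟨σ :: l, by simp [hl], fun u v => by
      rw [List.map_cons, List.sum_cons, hlM, hM, add_comm]⟩

lemma exists_mixture_eq {K : ℕ} (hK : 0 < K) {M : U → U → ℕ} (hrow : ∀ u, ∑ v, M u v = K)
    (hcol : ∀ v, ∑ u, M u v = K) : ∃ Λ : List (ℝ × Finset (U × U)), Λ.length = K ∧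
      (∀ p ∈ Λ, 0 < p.1) ∧ (∀ p ∈ Λ, IsPartialPerm p.2) ∧ (Λ.map Prod.fst).sum = 1 ∧
      mixture Λ = fun t => (M t.1 t.2 : ℝ) / K := by
  obtain ⟨l, hl, hlM⟩ := exists_list_perm K hrow hcol
  have hK' : (0 : ℝ) < K := by exact_mod_cast hK
  refine ⟨l.map fun σ => ((K : ℝ)⁻¹, Finset.univ.filter fun t => σ t.1 = t.2), by simp [hl],
    fun p hp => ?_, fun p hp => ?_, ?_, ?_⟩
  · obtain ⟨σ, -, rfl⟩ := List.mem_map.1 hp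
    exact inv_pos.2 hK'
  · obtain ⟨σ, -, rfl⟩ := List.mem_map.1 hp
    intro s hs t ht hst
    simp only [Finset.mem_filter, Finset.mem_univ, true_and] at hs ht
    rcases hst with h | h
    · exact Prod.ext h (by rw [← hs, ← ht, h])
    · exact Prod.ext (σ.injective (by rw [hs, ht, h])) h
  · simp [Function.comp_def, hl, hK'.ne']
  · funext t
    rw [← hlM, mixture, List.map_map, Nat.cast_list_sum, List.map_map, div_eq_mul_inv,
      ← List.sum_map_mul_right]
    congr 1
    refine List.map_congr_left fun σ _ => ?_
    simp only [Function.comp, Finset.mem_filter, Finset.mem_univ, true_and]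
    split_ifs <;> simp

end Decomposition

section Cells

variable {X C E : Type} [Fintype X] [DecidableEq X] [Fintype C] [DecidableEq C] [Fintype E]
  [DecidableEq E]

/-- The number of edges of color `k` owned by `v`. -/
def ownCount (o : E → X) (c : E → C) (v : X) (k : C) : ℕ :=
  (Finset.univ.filter fun e => o e = v ∧ c e = k).card

/-- The positions used by an edge with owner `o e`, other end `w e` and color `c e`. -/
def cells (o w : E → X) (c : E → C) (h : E → Prop) [DecidablePred h] (e : E) :
    Finset ((X ⊕ C) × (X ⊕ C)) :=
  if h e then {(Sum.inl (o e), Sum.inr (c e)), (Sum.inl (w e), Sum.inl (w e))}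
  else {(Sum.inl (o e), Sum.inl (o e)), (Sum.inl (w e), Sum.inl (w e)),
    (Sum.inr (c e), Sum.inr (c e))}

section Mem

omit [Fintype X] [Fintype C] [Fintype E] [DecidableEq E]

variable (o w : E → X) (c : E → C) (h : E → Prop) [DecidablePred h] (e : E)

lemma inl_inr_mem_cells {v : X} {k : C} :
    (Sum.inl v, Sum.inr k) ∈ cells o w c h e ↔ h e ∧ o e = v ∧ c e = k := by
  unfold cells
  split_ifs with he <;> simp [he, eq_comm]

lemma inl_inl_mem_cells {u v : X} :
    (Sum.inl u, Sum.inl v) ∈ cells o w c h e ↔ u = v ∧ (¬ h e ∧ o e = v ∨ w e = v) := by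
  unfold cells
  split_ifs with he <;> (simp [he]; grind)

lemma inr_inr_mem_cells {k l : C} :
    (Sum.inr k, Sum.inr l) ∈ cells o w c h e ↔ k = l ∧ ¬ h e ∧ c e = k := by
  unfold cells
  split_ifs with he
  · simp [he]
  · simp [he]
    grind

lemma inr_inl_notMem_cells {v : X} {k : C} : (Sum.inr k, Sum.inl v) ∉ cells o w c h e := by
  unfold cells
  split_ifs with he <;> simp

lemma cells_nonempty_card_le : (cells o w c h e).Nonempty ∧ (cells o w c h e).card ≤ 3 := by
  unfold cells
  split_ifs with he
  · exact ⟨by simp, Finset.card_le_two.trans (by norm_num)⟩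
  · exact ⟨by simp, Finset.card_le_three⟩

lemma exists_mem_cells_owner : ∃ t ∈ cells o w c h e, t.1 = Sum.inl (o e) := by
  unfold cells
  split_ifs with he <;> simp

lemma exists_mem_cells_other : ∃ t ∈ cells o w c h e, t.1 = Sum.inl (w e) := by
  unfold cells
  split_ifs with he <;> simp

lemma exists_mem_cells_color : ∃ t ∈ cells o w c h e, t.2 = Sum.inr (c e) := by
  unfold cells
  split_ifs with he <;> simp

end Mem

omit [DecidableEq E] in
/-- Symmetric integer matrices with line sums `K` that approximate the densities of heavy pairs. -/
lemma exists_heavy_matrix (o : E → X) (c : E → C) {κ δ : ℝ} {K n : ℕ} (hκ : 0 < κ) (hκ1 : κ ≤ 1)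
    (hn : 0 < n) (hK : 1 ≤ K * κ * δ) (ho : ∀ v, (Finset.univ.filter fun e => o e = v).card ≤ n)
    (hc : ∀ k, (Finset.univ.filter fun e => c e = k).card ≤ n) :
    ∃ M : X ⊕ C → X ⊕ C → ℕ, (∀ u, ∑ v, M u v = K) ∧ (∀ v, ∑ u, M u v = K) ∧
      (∀ v, K * (n - (1 - κ) *
        (Finset.univ.filter fun e => o e = v ∧ δ * n ≤ ownCount o c (o e) (c e)).card) ≤
          n * M (Sum.inl v) (Sum.inl v)) ∧
      (∀ k, K * (n - (1 - κ) *
        (Finset.univ.filter fun e => c e = k ∧ δ * n ≤ ownCount o c (o e) (c e)).card) ≤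
          n * M (Sum.inr k) (Sum.inr k)) ∧
      ∀ v k, δ * n ≤ ownCount o c v k →
        K * (1 - 2 * κ) * ownCount o c v k ≤ n * M (Sum.inl v) (Sum.inr k) := by
  have hn' : (0 : ℝ) < n := by exact_mod_cast hn
  set m : X → C → ℕ := fun v k =>
    if δ * n ≤ ownCount o c v k then ⌊K * (1 - κ) * ownCount o c v k / n⌋₊ else 0 with hm
  set a : X → C → ℕ := fun v k => if δ * n ≤ ownCount o c v k then ownCount o c v k else 0 with ha
  have hma : ∀ v k, (n : ℝ) * m v k ≤ K * (1 - κ) * a v k := fun v k => by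
    simp only [hm, ha]
    split_ifs with h
    · have h1 := Nat.floor_le (a := K * (1 - κ) * ownCount o c v k / n)
        (div_nonneg (mul_nonneg (mul_nonneg (Nat.cast_nonneg _) (by linarith))
          (Nat.cast_nonneg _)) hn'.le)
      rwa [le_div_iff₀ hn', mul_comm] at h1
    · simp
  have hcount : ∀ v k, (Finset.univ.filter fun e =>
      o e = v ∧ c e = k ∧ δ * n ≤ ownCount o c (o e) (c e)).card = a v k := fun v k => by
    simp only [ha]
    split_ifs with h
    · refine congrArg Finset.card (Finset.filter_congr fun e _ => ?_)
      constructor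
      · tauto
      · rintro ⟨rfl, rfl⟩
        exact ⟨rfl, rfl, h⟩
    · rw [Finset.card_eq_zero, Finset.filter_eq_empty_iff]
      rintro e - ⟨rfl, rfl, h1⟩
      exact h h1
  have hrow : ∀ v, ∑ k, a v k =
      (Finset.univ.filter fun e => o e = v ∧ δ * n ≤ ownCount o c (o e) (c e)).card := fun v => by
    rw [Finset.card_eq_sum_card_fiberwise (f := c) (t := Finset.univ) (fun _ _ => by simp)]
    refine Finset.sum_congr rfl fun k _ => ?_
    rw [Finset.filter_filter, ← hcount]
    exact congrArg Finset.card (Finset.filter_congr fun e _ => by tauto)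
  have hcol : ∀ k, ∑ v, a v k =
      (Finset.univ.filter fun e => c e = k ∧ δ * n ≤ ownCount o c (o e) (c e)).card := fun k => by
    rw [Finset.card_eq_sum_card_fiberwise (f := o) (t := Finset.univ) (fun _ _ => by simp)]
    refine Finset.sum_congr rfl fun v _ => ?_
    rw [Finset.filter_filter, ← hcount]
    exact congrArg Finset.card (Finset.filter_congr fun e _ => by tauto)
  have bound : ∀ {ι : Type} (s : Finset ι) (f g : ι → ℕ),
      (∀ i, (n : ℝ) * f i ≤ K * (1 - κ) * g i) → ∑ i ∈ s, g i ≤ n →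
      ∑ i ∈ s, f i ≤ K ∧ (K * (n - (1 - κ) * (∑ i ∈ s, g i : ℕ)) : ℝ) ≤
        n * (K - ∑ i ∈ s, f i : ℕ) := fun s f g hfg hg => by
    have h1 : (n : ℝ) * (∑ i ∈ s, f i : ℕ) ≤ K * (1 - κ) * (∑ i ∈ s, g i : ℕ) := by
      push_cast
      rw [Finset.mul_sum, Finset.mul_sum]
      exact Finset.sum_le_sum fun i _ => hfg i
    have h2 : ((∑ i ∈ s, g i : ℕ) : ℝ) ≤ n := by exact_mod_cast hg
    have h3 : ∑ i ∈ s, f i ≤ K := by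
      have : (n : ℝ) * (∑ i ∈ s, f i : ℕ) ≤ n * K := by
        calc _ ≤ _ := h1
          _ ≤ K * 1 * n := by gcongr; linarith
          _ = _ := by ring
      exact_mod_cast le_of_mul_le_mul_left this hn'
    refine ⟨h3, ?_⟩
    rw [Nat.cast_sub h3]
    linarith
  have hbr := fun v => bound Finset.univ (m v) (a v) (hma v) (by
    rw [hrow]
    exact (Finset.card_le_card fun e => by simp +contextual).trans (ho v))
  have hbc := fun k => bound Finset.univ (fun v => m v k) (fun v => a v k) (fun v => hma v k) (by
    rw [hcol]
    exact (Finset.card_le_card fun e => by simp +contextual).trans (hc k))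
  refine ⟨fun u v => match u, v with
    | Sum.inl u, Sum.inl v => if u = v then K - ∑ k, m u k else 0
    | Sum.inl v, Sum.inr k => m v k
    | Sum.inr k, Sum.inl v => m v k
    | Sum.inr k, Sum.inr l => if k = l then K - ∑ v, m v k else 0, ?_, ?_, ?_, ?_, ?_⟩
  · rintro (v | k)
    · simpa [Fintype.sum_sum_type] using Nat.sub_add_cancel (hbr v).1
    · simpa [Fintype.sum_sum_type] using Nat.add_sub_cancel' (hbc k).1
  · rintro (v | k)
    · simpa [Fintype.sum_sum_type] using Nat.sub_add_cancel (hbr v).1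
    · simpa [Fintype.sum_sum_type] using Nat.add_sub_cancel' (hbc k).1
  · intro v
    rw [← hrow]
    simpa using (hbr v).2
  · intro k
    rw [← hcol]
    simpa using (hbc k).2
  · intro v k h
    simp only [hm, h, if_true]
    have h1 := (Nat.lt_floor_add_one (K * (1 - κ) * ownCount o c v k / n)).le
    rw [div_le_iff₀ hn'] at h1
    have h2 : K * κ * (δ * n) ≤ K * κ * ownCount o c v k := by gcongr
    have h3 : 1 * (n : ℝ) ≤ K * κ * δ * n := by gcongr
    linarith

end Cells

section Owned

variable {X C E : Type} [Fintype X] [DecidableEq X] [DecidableEq C] [Fintype E]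
  [DecidableEq E]

/-- The number of edges of color `k` at `v`, for edges with ends `o e` and `w e`. -/
def incCount (o w : E → X) (c : E → C) (v : X) (k : C) : ℕ :=
  (Finset.univ.filter fun e => (o e = v ∨ w e = v) ∧ c e = k).card

/-- A simple `n`-regular graph, colored with each color used `n` times, where each edge `e` is owned
by an end `o e` that meets its color at least as often as the other end `w e`. -/
structure IsOwned (o w : E → X) (c : E → C) (n : ℕ) : Prop where
  ne : ∀ e, o e ≠ w e
  simple : ∀ e f, o e = o f ∧ w e = w f ∨ o e = w f ∧ w e = o f → e = f
  card_color : ∀ k, (Finset.univ.filter fun e => c e = k).card = n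
  card_inc : ∀ v, (Finset.univ.filter fun e => o e = v ∨ w e = v).card = n
  le_owner : ∀ e, incCount o w c (w e) (c e) ≤ incCount o w c (o e) (c e)

variable {o w : E → X} {c : E → C} {n : ℕ}

lemma IsOwned.sum_incCount_le (hG : IsOwned o w c n) (k : C) :
    ∑ v, incCount o w c v k ≤ 2 * n := by
  have h1 : ∀ f : E → X, ∑ v, (Finset.univ.filter fun e => f e = v ∧ c e = k).card = n :=
      fun f => by
    rw [← hG.card_color k,
      Finset.card_eq_sum_card_fiberwise (f := f) (t := Finset.univ) (fun _ _ => by simp)]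
    refine Finset.sum_congr rfl fun v _ => ?_
    rw [Finset.filter_filter]
    exact congrArg Finset.card (Finset.filter_congr fun e _ => by tauto)
  calc ∑ v, incCount o w c v k
      ≤ ∑ v, ((Finset.univ.filter fun e => o e = v ∧ c e = k).card +
        (Finset.univ.filter fun e => w e = v ∧ c e = k).card) :=
        Finset.sum_le_sum fun v _ => by
          refine (Finset.card_le_card ?_).trans (Finset.card_union_le _ _)
          intro e
          simp only [Finset.mem_filter, Finset.mem_univ, true_and, Finset.mem_union]
          tauto
    _ = 2 * n := by rw [Finset.sum_add_distrib, h1, h1, two_mul]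

lemma IsOwned.card_light_le (hG : IsOwned o w c n) {δ : ℝ} (hδ : 0 < δ) (hn : 0 < n) (v : X)
    (k : C) : ((Finset.univ.filter fun e => (ownCount o c (o e) (c e) : ℝ) < δ * n ∧
      (o e = v ∨ w e = v) ∧ c e = k).card : ℝ) ≤ δ * n + 2 / δ := by
  have hn' : (0 : ℝ) < n := by exact_mod_cast hn
  rcases lt_or_ge (incCount o w c v k : ℝ) (δ * n) with h | h
  · have h1 : ((Finset.univ.filter fun e => (ownCount o c (o e) (c e) : ℝ) < δ * n ∧
        (o e = v ∨ w e = v) ∧ c e = k).card : ℝ) ≤ incCount o w c v k := by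
      refine Nat.cast_le.2 (Finset.card_le_card fun e => ?_)
      simp only [Finset.mem_filter, Finset.mem_univ, true_and]
      tauto
    have : 0 < 2 / δ := by positivity
    linarith
  · set A := Finset.univ.filter fun e => (ownCount o c (o e) (c e) : ℝ) < δ * n ∧ o e = v ∧ c e = k
    set B := Finset.univ.filter fun e => w e = v ∧ c e = k
    set H := Finset.univ.filter fun u => δ * n ≤ incCount o w c u k
    have hAB : ((Finset.univ.filter fun e => (ownCount o c (o e) (c e) : ℝ) < δ * n ∧
        (o e = v ∨ w e = v) ∧ c e = k).card : ℝ) ≤ A.card + B.card := by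
      rw [← Nat.cast_add]
      refine Nat.cast_le.2 ((Finset.card_le_card fun e => ?_).trans (Finset.card_union_le _ _))
      simp only [A, B, Finset.mem_filter, Finset.mem_univ, true_and, Finset.mem_union]
      tauto
    have hA : (A.card : ℝ) ≤ δ * n := by
      rcases A.eq_empty_or_nonempty with h0 | ⟨e, he⟩
      · rw [h0]
        simp only [Finset.card_empty, Nat.cast_zero]
        positivity
      · obtain ⟨h1, rfl, rfl⟩ := (Finset.mem_filter.1 he).2
        refine h1.le.trans' (Nat.cast_le.2 (Finset.card_le_card fun f => ?_))
        simp only [A, Finset.mem_filter, Finset.mem_univ, true_and]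
        tauto
    have hBH : (B.card : ℝ) ≤ H.card := by
      refine Nat.cast_le.2 (Finset.card_le_card_of_injOn o (fun e he => ?_) fun e he f hf hef => ?_)
      · obtain ⟨rfl, rfl⟩ := (Finset.mem_filter.1 (Finset.mem_coe.1 he)).2
        refine Finset.mem_coe.2 (Finset.mem_filter.2 ⟨Finset.mem_univ _, h.trans ?_⟩)
        exact_mod_cast hG.le_owner e
      · have h1 := (Finset.mem_filter.1 (Finset.mem_coe.1 he)).2
        have h2 := (Finset.mem_filter.1 (Finset.mem_coe.1 hf)).2
        exact hG.simple e f (Or.inl ⟨hef, h1.1.trans h2.1.symm⟩)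
    have hH : (H.card : ℝ) ≤ 2 / δ := by
      rw [le_div_iff₀ hδ]
      have h1 : H.card * (δ * n) ≤ ∑ u ∈ H, (incCount o w c u k : ℝ) := by
        rw [← nsmul_eq_mul]
        exact Finset.card_nsmul_le_sum _ _ _ fun u hu => (Finset.mem_filter.1 hu).2
      have h2 : ∑ u ∈ H, (incCount o w c u k : ℝ) ≤ 2 * n := by
        calc _ ≤ ∑ u, (incCount o w c u k : ℝ) :=
              Finset.sum_le_sum_of_subset_of_nonneg (Finset.subset_univ _)
                fun _ _ _ => Nat.cast_nonneg _
          _ ≤ 2 * n := by exact_mod_cast hG.sum_incCount_le k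
      have h3 : H.card * δ * n ≤ 2 * n := by linarith
      exact le_of_mul_le_mul_right h3 hn'
    linarith

omit [Fintype X] [DecidableEq E] in
lemma IsOwned.cells_pair (hG : IsOwned o w c n) (h : E → Prop) [DecidablePred h]
    {t t' : (X ⊕ C) × (X ⊕ C)} (htt' : t ≠ t') :
    (∀ e f, t ∈ cells o w c h e → t' ∈ cells o w c h e → t ∈ cells o w c h f →
      t' ∈ cells o w c h f → e = f) ∨
    ∃ v k, ∀ e, t ∈ cells o w c h e → t' ∈ cells o w c h e →
      ¬ h e ∧ (o e = v ∨ w e = v) ∧ c e = k := by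
  have hs := hG.simple
  have hne := hG.ne
  obtain ⟨a | a, b | b⟩ := t <;> obtain ⟨a' | a', b' | b'⟩ := t' <;>
    simp only [inl_inl_mem_cells, inl_inr_mem_cells, inr_inr_mem_cells, inr_inl_notMem_cells,
      false_imp_iff, imp_true_iff, true_or]
  · left
    intro e f h1 h2 h3 h4
    obtain ⟨rfl, h1⟩ := h1
    obtain ⟨rfl, h2⟩ := h2
    have hab : a ≠ a' := fun h => htt' (by rw [h])
    apply hs
    grind
  · left
    intro e f h1 h2 h3 h4
    apply hs
    grind
  · right
    exact ⟨b, a', by grind⟩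
  · left
    intro e f h1 h2 h3 h4
    apply hs
    grind
  · left
    intro e f h1 h2 h3 h4
    grind
  · left
    intro e f h1 h2 h3 h4
    grind
  · right
    exact ⟨b', a, by grind⟩
  · left
    intro e f h1 h2 h3 h4
    grind
  · left
    intro e f h1 h2 h3 h4
    grind

/-- The number of edges using a given position is controlled by the heavy matrix. -/
lemma IsOwned.exists_mixture [Fintype C] (hG : IsOwned o w c n) {κ δ : ℝ} {k : ℕ} (hκ : 0 < κ)
    (hκ1 : κ ≤ 1 / 4) (hn : 0 < n) (hK : 1 ≤ (k + 1 : ℕ) * κ * δ) :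
    ∃ Λ : List (ℝ × Finset ((X ⊕ C) × (X ⊕ C))), Λ.length = k + 1 ∧
      (∀ p ∈ Λ, 0 < p.1) ∧ (∀ p ∈ Λ, IsPartialPerm p.2) ∧ (Λ.map Prod.fst).sum = 1 ∧
      (∀ v, κ ≤ mixture Λ (Sum.inl v, Sum.inl v)) ∧ (∀ l, κ ≤ mixture Λ (Sum.inr l, Sum.inr l)) ∧
      (∀ v l, δ * n ≤ ownCount o c v l → (1 - 2 * κ) * δ ≤ mixture Λ (Sum.inl v, Sum.inr l)) ∧
      ∀ t, ((Finset.univ.filter fun e => t ∈ cells o w c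
          (fun e => δ * n ≤ ownCount o c (o e) (c e)) e).card : ℝ) ≤ n ∧
        (1 - 2 * κ) * (Finset.univ.filter fun e => t ∈ cells o w c
          (fun e => δ * n ≤ ownCount o c (o e) (c e)) e).card ≤ n * mixture Λ t := by
  have hn' : (0 : ℝ) < n := by exact_mod_cast hn
  have hK' : (0 : ℝ) < (k + 1 : ℕ) := by positivity
  have ho : ∀ v, (Finset.univ.filter fun e => o e = v).card ≤ n := fun v => by
    rw [← hG.card_inc v]
    exact Finset.card_le_card fun e => by simp +contextual
  obtain ⟨M, hrow, hcol, hv, hc, hvc⟩ := exists_heavy_matrix o c hκ (by linarith) hn hK ho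
    fun l => (hG.card_color l).le
  obtain ⟨Λ, h1, h2, h3, h4, h5⟩ := exists_mixture_eq k.succ_pos hrow hcol
  have hscale : ∀ (r : ℝ) (u u' : X ⊕ C), (k + 1 : ℕ) * r ≤ n * M u u' →
      r ≤ n * mixture Λ (u, u') := fun r u u' h => by
    rw [h5]
    simp only
    rw [← mul_div_assoc, le_div_iff₀ hK', mul_comm]
    exact h
  set h : E → Prop := fun e => δ * n ≤ ownCount o c (o e) (c e) with hh
  set Hv : X → ℕ := fun v => (Finset.univ.filter fun e => o e = v ∧ h e).card with hHv
  set Hc : C → ℕ := fun l => (Finset.univ.filter fun e => c e = l ∧ h e).card with hHc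
  have hv' : ∀ v, n - (1 - κ) * Hv v ≤ n * mixture Λ (Sum.inl v, Sum.inl v) := fun v =>
    hscale _ _ _ (hv v)
  have hc' : ∀ l, n - (1 - κ) * Hc l ≤ n * mixture Λ (Sum.inr l, Sum.inr l) := fun l =>
    hscale _ _ _ (hc l)
  have hvc' : ∀ v l, δ * n ≤ ownCount o c v l →
      (1 - 2 * κ) * ownCount o c v l ≤ n * mixture Λ (Sum.inl v, Sum.inr l) := fun v l hvl =>
    hscale _ _ _ (by rw [← mul_assoc]; exact hvc v l hvl)
  have hNv : ∀ v, (((Finset.univ.filter fun e =>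
      (Sum.inl v, Sum.inl v) ∈ cells o w c h e).card : ℝ)) + Hv v ≤ n := fun v => by
    rw [hHv, ← Nat.cast_add, ← Finset.card_union_of_disjoint]
    · refine Nat.cast_le.2 ((hG.card_inc v).le.trans' (Finset.card_le_card fun e => ?_))
      simp only [Finset.mem_union, Finset.mem_filter, Finset.mem_univ, true_and,
        inl_inl_mem_cells]
      tauto
    · refine Finset.disjoint_filter.2 fun e _ he => ?_
      have := hG.ne e
      rw [inl_inl_mem_cells] at he
      grind
  have hNc : ∀ l, (((Finset.univ.filter fun e =>
      (Sum.inr l, Sum.inr l) ∈ cells o w c h e).card : ℝ)) + Hc l ≤ n := fun l => by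
    rw [hHc, ← Nat.cast_add, ← Finset.card_union_of_disjoint]
    · refine Nat.cast_le.2 ((hG.card_color l).le.trans' (Finset.card_le_card fun e => ?_))
      simp only [Finset.mem_union, Finset.mem_filter, Finset.mem_univ, true_and,
        inr_inr_mem_cells]
      tauto
    · refine Finset.disjoint_filter.2 fun e _ he => ?_
      rw [inr_inr_mem_cells] at he
      tauto
  have diag : ∀ a b x : ℝ, 0 ≤ a → 0 ≤ b → a + b ≤ n → n - (1 - κ) * b ≤ n * x →
      κ ≤ x ∧ a ≤ n ∧ (1 - 2 * κ) * a ≤ n * x := fun a b x ha hb hab hx => by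
    have h6 : 0 ≤ κ * a := by positivity
    have h7 : 0 ≤ κ * b := by positivity
    refine ⟨?_, by linarith, by linarith⟩
    have h8 : (1 - κ) * b ≤ (1 - κ) * n := by
      apply mul_le_mul_of_nonneg_left <;> linarith
    have h9 : n * κ ≤ n * x := by linarith
    exact le_of_mul_le_mul_left h9 hn'
  have hdv := fun v => diag _ _ _ (Nat.cast_nonneg _) (Nat.cast_nonneg _) (hNv v) (hv' v)
  have hdc := fun l => diag _ _ _ (Nat.cast_nonneg _) (Nat.cast_nonneg _) (hNc l) (hc' l)
  refine ⟨Λ, h1, h2, h3, h4, fun v => (hdv v).1, fun l => (hdc l).1, fun v l hvl => ?_, fun t => ?_⟩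
  · have h6 : n * ((1 - 2 * κ) * δ) ≤ n * mixture Λ (Sum.inl v, Sum.inr l) := by
      refine (hvc' v l hvl).trans' ?_
      calc n * ((1 - 2 * κ) * δ) = (1 - 2 * κ) * (δ * n) := by ring
        _ ≤ _ := mul_le_mul_of_nonneg_left hvl (by linarith)
    exact le_of_mul_le_mul_left h6 hn'
  · have hempty : (∀ e, t ∉ cells o w c h e) →
        ((Finset.univ.filter fun e => t ∈ cells o w c h e).card : ℝ) ≤ n ∧
        (1 - 2 * κ) * (Finset.univ.filter fun e => t ∈ cells o w c h e).card ≤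
          n * mixture Λ t := fun ht => by
      rw [Finset.filter_false_of_mem fun e _ => ht e]
      simp only [Finset.card_empty, Nat.cast_zero, mul_zero]
      exact ⟨hn'.le, mul_nonneg hn'.le (mixture_nonneg h2 t)⟩
    obtain ⟨a | a, b | b⟩ := t
    · by_cases hab : a = b
      · subst hab
        exact (hdv a).2
      · exact hempty fun e he => hab ((inl_inl_mem_cells o w c h e).1 he).1
    · by_cases hab : δ * n ≤ ownCount o c a b
      · have h6 : ((Finset.univ.filter fun e =>
            (Sum.inl a, Sum.inr b) ∈ cells o w c h e).card : ℝ) ≤ ownCount o c a b := by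
          refine Nat.cast_le.2 (Finset.card_le_card fun e => ?_)
          simp only [Finset.mem_filter, Finset.mem_univ, true_and, inl_inr_mem_cells]
          tauto
        have h7 : (ownCount o c a b : ℝ) ≤ n := by
          refine Nat.cast_le.2 ((ho a).trans' (Finset.card_le_card fun e => ?_))
          simp only [Finset.mem_filter, Finset.mem_univ, true_and]
          tauto
        exact ⟨h6.trans h7, (hvc' a b hab).trans'
          (mul_le_mul_of_nonneg_left h6 (by linarith))⟩
      · refine hempty fun e he => hab ?_
        obtain ⟨h6, rfl, rfl⟩ := (inl_inr_mem_cells o w c h e).1 he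
        exact h6
    · exact hempty fun e => inr_inl_notMem_cells o w c h e
    · by_cases hab : a = b
      · subst hab
        exact (hdc a).2
      · exact hempty fun e he => hab ((inr_inr_mem_cells o w c h e).1 he).1

end Owned

section Scale

variable {X C E : Type} [Fintype X] [DecidableEq X] [Fintype C] [DecidableEq C] [Fintype E]
  [DecidableEq E] {o w : E → X} {c : E → C} {n : ℕ}

lemma IsOwned.exists_matching_of_scale (hG : IsOwned o w c n) {κ δ δ' ε η : ℝ} {k : ℕ} (hκ : 0 < κ)
    (hκ1 : κ ≤ 1 / 4) (hδ' : 0 < δ') (hδ'δ : δ' ≤ δ) (hδ1 : δ ≤ 1) (hn : 0 < n)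
    (hK : 1 ≤ (k + 1 : ℕ) * κ * δ) (hround : RoundsMixtures k (1 / (κ ^ 3 * δ)) ε η)
    (hη : 1 / (κ ^ 3 * δ) ≤ η * n) (hη' : δ' * n + 2 / δ' ≤ κ ^ 3 * η * n)
    (hwin : ((Finset.univ.filter fun e => δ' * n ≤ ownCount o c (o e) (c e) ∧
      (ownCount o c (o e) (c e) : ℝ) < δ * n).card : ℝ) ≤ κ * n ^ 2)
    (hE : Fintype.card E = n ^ 2) :
    ∃ M : Finset E, (∀ e ∈ M, ∀ f ∈ M, e ≠ f →
        o e ≠ o f ∧ o e ≠ w f ∧ w e ≠ w f ∧ c e ≠ c f) ∧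
      (1 - 3 * κ) * n - ε * Fintype.card (X ⊕ C) ≤ M.card := by
  have hn' : (0 : ℝ) < n := by exact_mod_cast hn
  have hδ : 0 < δ := hδ'.trans_le hδ'δ
  obtain ⟨Λ, h1, h2, h3, h4, hxv, hxc, hxvc, hN⟩ := hG.exists_mixture hκ hκ1 hn hK
  set h : E → Prop := fun e => δ * n ≤ ownCount o c (o e) (c e) with hh
  set V := cells o w c h with hV
  set x := mixture Λ with hx
  have hx0 : ∀ t, 0 ≤ x t := mixture_nonneg h2
  have hlight : ∀ e, ¬ h e → κ ^ 3 ≤ ∏ t ∈ V e, x t := fun e he => by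
    simp only [hV, cells, he, if_false]
    rw [Finset.prod_insert (by simp [hG.ne e]), Finset.prod_insert (by simp), Finset.prod_singleton]
    calc κ ^ 3 = κ * (κ * κ) := by ring
      _ ≤ _ := mul_le_mul (hxv _) (mul_le_mul (hxv _) (hxc _) hκ.le (hx0 _)) (by positivity) (hx0 _)
  have hheavy : ∀ e, h e → κ ^ 3 * δ ≤ ∏ t ∈ V e, x t := fun e he => by
    have h5 := hxvc (o e) (c e) he
    simp only [hV, cells, he, if_true]
    rw [Finset.prod_insert (by simp), Finset.prod_singleton]
    have h6 : κ ^ 2 ≤ 1 - 2 * κ := by nlinarith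
    calc κ ^ 3 * δ = κ ^ 2 * δ * κ := by ring
      _ ≤ (1 - 2 * κ) * δ * κ := by gcongr
      _ ≤ _ := by
        gcongr
        exacts [hx0 _, hxv _]
  have hprod : ∀ e, κ ^ 3 * δ ≤ ∏ t ∈ V e, x t := fun e => by
    by_cases he : h e
    · exact hheavy e he
    · exact (hlight e he).trans' (mul_le_of_le_one_right (by positivity) hδ1)
  have hprod0 : ∀ e, 0 < ∏ t ∈ V e, x t := fun e => (hprod e).trans_lt' (by positivity)
  set win : E → Prop := fun e => δ' * n ≤ ownCount o c (o e) (c e) ∧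
    (ownCount o c (o e) (c e) : ℝ) < δ * n with hwindef
  set y : E → ℝ := fun e => if win e then 0 else (1 - 2 * κ) / (n * ∏ t ∈ V e, x t) with hy
  have hκ2 : 0 ≤ 1 - 2 * κ := by linarith
  have hfrac : ∀ e, 0 ≤ (1 - 2 * κ) / (n * ∏ t ∈ V e, x t) := fun e =>
    div_nonneg hκ2 (mul_nonneg hn'.le (hprod0 e).le)
  have hy0 : ∀ e, 0 ≤ y e := fun e => by
    simp only [hy]
    split_ifs
    exacts [le_rfl, hfrac e]
  have hy1 : ∀ e, y e ≤ (1 - 2 * κ) / (n * ∏ t ∈ V e, x t) := fun e => by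
    simp only [hy]
    split_ifs
    exacts [hfrac e, le_rfl]
  have hyle : ∀ e (b : ℝ), 0 < b → b ≤ ∏ t ∈ V e, x t → y e ≤ 1 / (n * b) := fun e b hb hbp =>
    (hy1 e).trans (by
      gcongr
      linarith)
  have hyD : ∀ e, y e ≤ 1 / (n * (κ ^ 3 * δ)) := fun e =>
    hyle e _ (by positivity) (hprod e)
  have hload : ∀ t, load V x y t ≤ 1 := fun t => by
    rcases (hx0 t).eq_or_lt with h0 | hpos
    · have : (Finset.univ.filter fun e => t ∈ V e) = ∅ := Finset.filter_false_of_mem fun e _ he =>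
        (hprod0 e).ne' (Finset.prod_eq_zero he h0.symm)
      rw [load, this, Finset.sum_empty]
      exact zero_le_one
    · calc load V x y t ≤ ∑ e with t ∈ V e, (1 - 2 * κ) / (n * x t) :=
            Finset.sum_le_sum fun e he => by
              have ht := (Finset.mem_filter.1 he).2
              have h5 := Finset.mul_prod_erase (V e) x ht
              have h6 : 0 < ∏ t' ∈ (V e).erase t, x t' := by
                have := hprod0 e
                rw [← h5] at this
                exact (mul_pos_iff_of_pos_left hpos).1 this
              refine (mul_le_mul_of_nonneg_right (hy1 e) h6.le).trans_eq ?_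
              rw [← h5]
              field_simp
        _ = (1 - 2 * κ) * (Finset.univ.filter fun e => t ∈ V e).card / (n * x t) := by
            rw [Finset.sum_const, nsmul_eq_mul]
            ring
        _ ≤ 1 := div_le_one_of_le₀ (hN t).2 (by positivity)
  have hdeg : ∀ t, ∑ e with t ∈ V e, y e ≤ 1 / (κ ^ 3 * δ) := fun t => by
    calc ∑ e with t ∈ V e, y e ≤ (Finset.univ.filter fun e => t ∈ V e).card •
          (1 / (n * (κ ^ 3 * δ))) := Finset.sum_le_card_nsmul _ _ _ fun e _ => hyD e
      _ ≤ n * (1 / (n * (κ ^ 3 * δ))) := by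
          rw [nsmul_eq_mul]
          exact mul_le_mul_of_nonneg_right (hN t).1 (by positivity)
      _ = _ := by field_simp
  have hyη : ∀ e, y e ≤ η := fun e => (hyD e).trans (by
    rw [div_le_iff₀ (by positivity)] at hη ⊢
    linarith)
  have hη0 : 0 ≤ η := by
    have h5 : 0 < η * n := hη.trans_lt' (by positivity)
    exact (pos_of_mul_pos_left h5 hn'.le).le
  have hcod : ∀ t t', t ≠ t' → ∑ e with t ∈ V e ∧ t' ∈ V e, y e ≤ η := fun t t' htt' => by
    rcases hG.cells_pair h htt' with hs | ⟨v, l, hs⟩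
    · rcases (Finset.univ.filter fun e => t ∈ V e ∧ t' ∈ V e).eq_empty_or_nonempty with h0 | ⟨e, he⟩
      · rw [h0, Finset.sum_empty]
        exact hη0
      · have h5 : (Finset.univ.filter fun e => t ∈ V e ∧ t' ∈ V e) = {e} :=
          Finset.eq_singleton_iff_unique_mem.2 ⟨he, fun f hf => by
            have h6 := (Finset.mem_filter.1 he).2
            have h7 := (Finset.mem_filter.1 hf).2
            exact hs f e h7.1 h7.2 h6.1 h6.2⟩
        rw [h5, Finset.sum_singleton]
        exact hyη e
    · set A := Finset.univ.filter fun e => (ownCount o c (o e) (c e) : ℝ) < δ' * n ∧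
        (o e = v ∨ w e = v) ∧ c e = l with hA
      have hAc : (A.card : ℝ) ≤ δ' * n + 2 / δ' := hG.card_light_le hδ' hn v l
      calc ∑ e with t ∈ V e ∧ t' ∈ V e, y e
          ≤ ∑ e with t ∈ V e ∧ t' ∈ V e, if e ∈ A then 1 / (n * κ ^ 3) else 0 :=
            Finset.sum_le_sum fun e he => by
              have h6 := (Finset.mem_filter.1 he).2
              obtain ⟨h7, h8⟩ := hs e h6.1 h6.2
              split_ifs with h9
              · exact hyle e _ (by positivity) (hlight e h7)
              · have h10 : win e := by
                  simp only [hA, Finset.mem_filter, Finset.mem_univ, true_and] at h9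
                  refine ⟨?_, not_le.1 h7⟩
                  by_contra h11
                  exact h9 ⟨not_le.1 h11, h8⟩
                simp [hy, h10]
        _ ≤ ∑ e, if e ∈ A then 1 / (n * κ ^ 3) else 0 :=
            Finset.sum_le_sum_of_subset_of_nonneg (Finset.subset_univ _) fun e _ _ => by
              split_ifs
              exacts [by positivity, le_rfl]
        _ = A.card * (1 / (n * κ ^ 3)) := by
            rw [Finset.sum_ite_mem, Finset.univ_inter, Finset.sum_const, nsmul_eq_mul]
        _ ≤ κ ^ 3 * η * n * (1 / (n * κ ^ 3)) := by
            gcongr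
            exact hAc.trans hη'
        _ = η := by field_simp
  obtain ⟨ω, M, hω, hM, hdisj, hcard⟩ := hround (X ⊕ C) E V y Λ h1 h2 h3 h4 hy0
    (fun e => cells_nonempty_card_le o w c h e) hload hdeg hcod
  refine ⟨M, fun e he f hf hef => ?_, hcard.trans' ?_⟩
  · have hpos : ∀ s ∈ V e, ∀ t ∈ V f, ¬ (s.1 = t.1 ∨ s.2 = t.2) := fun s hs t ht hst => by
      have h5 := hω s ((hM e he).2 hs) t ((hM f hf).2 ht) hst
      exact Finset.disjoint_left.1 (hdisj e he f hf hef) hs (h5 ▸ ht)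
    obtain ⟨s, hs, hs'⟩ := exists_mem_cells_owner o w c h e
    obtain ⟨s₂, hs₂, hs₂'⟩ := exists_mem_cells_other o w c h e
    obtain ⟨s₃, hs₃, hs₃'⟩ := exists_mem_cells_color o w c h e
    obtain ⟨t, ht, ht'⟩ := exists_mem_cells_owner o w c h f
    obtain ⟨t₂, ht₂, ht₂'⟩ := exists_mem_cells_other o w c h f
    obtain ⟨t₃, ht₃, ht₃'⟩ := exists_mem_cells_color o w c h f
    refine ⟨fun h5 => hpos s hs t ht (Or.inl ?_), fun h5 => hpos s hs t₂ ht₂ (Or.inl ?_),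
      fun h5 => hpos s₂ hs₂ t₂ ht₂ (Or.inl ?_), fun h5 => hpos s₃ hs₃ t₃ ht₃ (Or.inr ?_)⟩
    · rw [hs', ht', h5]
    · rw [hs', ht₂', h5]
    · rw [hs₂', ht₂', h5]
    · rw [hs₃', ht₃', h5]
  · refine sub_le_sub_right ?_ _
    have h5 : ∀ e, y e * ∏ t ∈ V e, x t =
        (1 - 2 * κ) / n - if win e then (1 - 2 * κ) / n else 0 := fun e => by
      have := (hprod0 e).ne'
      simp only [hy]
      split_ifs
      · ring
      · field_simp
        ring
    rw [Finset.sum_congr rfl fun e _ => h5 e, Finset.sum_sub_distrib, Finset.sum_const,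
      Finset.card_univ, hE, nsmul_eq_mul, ← Finset.sum_filter, Finset.sum_const, nsmul_eq_mul, ← sub_mul]
    have h6 : (1 - κ) * n ^ 2 ≤ ((n ^ 2 : ℕ) : ℝ) - (Finset.univ.filter win).card := by
      push_cast
      linarith
    calc (1 - 3 * κ) * n ≤ (1 - κ) * (1 - 2 * κ) * n := by
          gcongr
          nlinarith [sq_nonneg κ]
      _ = (1 - κ) * n ^ 2 * ((1 - 2 * κ) / n) := by field_simp
      _ ≤ _ := mul_le_mul_of_nonneg_right h6 (div_nonneg hκ2 hn'.le)

end Scale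

/-- Few edges with multiplicity between `δ' * n` and `δ * n` are enough for a nearly perfect
rainbow matching. -/
def IsScaleStep (κ ε δ δ' : ℝ) : Prop :=
  ∃ n₀ : ℕ, ∀ n ≥ n₀, ∀ (X C E : Type) [Fintype X] [DecidableEq X]
    [Fintype C] [DecidableEq C] [Fintype E] [DecidableEq E] (o w : E → X) (c : E → C),
    IsOwned o w c n → Fintype.card E = n ^ 2 →
    ((Finset.univ.filter fun e => δ' * n ≤ ownCount o c (o e) (c e) ∧
      (ownCount o c (o e) (c e) : ℝ) < δ * n).card : ℝ) ≤ κ * n ^ 2 →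
    ∃ M : Finset E, (∀ e ∈ M, ∀ f ∈ M, e ≠ f →
        o e ≠ o f ∧ o e ≠ w f ∧ w e ≠ w f ∧ c e ≠ c f) ∧
      (1 - 3 * κ) * n - ε * Fintype.card (X ⊕ C) ≤ M.card

/-- Below any scale `δ` there is a scale `δ'` such that few edges with multiplicity in between are
enough for a nearly perfect rainbow matching. -/
lemma exists_scale {κ ε δ : ℝ} (hκ : 0 < κ) (hκ1 : κ ≤ 1 / 4) (hε : 0 < ε) (hδ : 0 < δ)
    (hδ1 : δ ≤ 1) :
    ∃ δ' : ℝ, 0 < δ' ∧ δ' ≤ δ ∧ IsScaleStep κ ε δ δ' := by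
  obtain ⟨k, hk⟩ := exists_nat_ge (1 / (κ * δ))
  have hK : 1 ≤ (k + 1 : ℕ) * κ * δ := by
    rw [div_le_iff₀ (by positivity)] at hk
    have : 0 < κ * δ := by positivity
    push_cast
    linarith
  obtain ⟨η, hη, hround⟩ := exists_roundsMixtures k (D := 1 / (κ ^ 3 * δ)) (by positivity) hε
  set δ' := min δ (κ ^ 3 * η / 2) with hδ'
  have hδ'0 : 0 < δ' := lt_min hδ (by positivity)
  obtain ⟨n₁, hn₁⟩ := exists_nat_ge (1 / (κ ^ 3 * δ) / η)
  obtain ⟨n₂, hn₂⟩ := exists_nat_ge (2 / δ' / (κ ^ 3 * η / 2))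
  refine ⟨δ', hδ'0, min_le_left _ _, n₁ + n₂ + 1, fun n hn X C E _ _ _ _ _ _ o w c hG hE hwin =>
    hG.exists_matching_of_scale hκ hκ1 hδ'0 (min_le_left _ _) hδ1 (by omega) hK hround ?_ ?_
      hwin hE⟩
  · rw [div_le_iff₀ hη] at hn₁
    have : (n₁ : ℝ) ≤ n := by exact_mod_cast (by omega : n₁ ≤ n)
    calc _ ≤ _ := hn₁
      _ ≤ n * η := by gcongr
      _ = _ := mul_comm _ _
  · rw [div_le_iff₀ (by positivity)] at hn₂
    have h1 : (n₂ : ℝ) * (κ ^ 3 * η / 2) ≤ n * (κ ^ 3 * η / 2) := by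
      have : (n₂ : ℝ) ≤ n := by exact_mod_cast (by omega : n₂ ≤ n)
      gcongr
    have h2 : δ' * n ≤ κ ^ 3 * η / 2 * n := by
      gcongr
      exact min_le_right _ _
    linarith

lemma exists_index_card_window_le {E : Type} [Fintype E] (g : E → ℝ) {d : ℕ → ℝ} (hd : Antitone d)
    {m : ℕ} (hm : 0 < m) {κ : ℝ} (hκ : 1 ≤ m * κ) :
    ∃ i < m, ((Finset.univ.filter fun e => d (i + 1) ≤ g e ∧ g e < d i).card : ℝ) ≤
      κ * Fintype.card E := by
  classical
  by_contra! h
  have hdisj : ((Finset.range m : Finset ℕ) : Set ℕ).PairwiseDisjoint fun i =>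
      Finset.univ.filter fun e => d (i + 1) ≤ g e ∧ g e < d i := by
    have key : ∀ i j, i < j → Disjoint (Finset.univ.filter fun e => d (i + 1) ≤ g e ∧ g e < d i)
        (Finset.univ.filter fun e => d (j + 1) ≤ g e ∧ g e < d j) := fun i j hij =>
      Finset.disjoint_filter.2 fun e _ h1 h2 =>
        (h2.2.trans_le (hd (Nat.succ_le_of_lt hij))).not_ge h1.1
    intro i _ j _ hij
    rcases lt_or_gt_of_ne hij with h1 | h1
    exacts [key i j h1, (key j i h1).symm]
  have h1 : ∑ i ∈ Finset.range m,
      (Finset.univ.filter fun e => d (i + 1) ≤ g e ∧ g e < d i).card ≤ Fintype.card E := by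
    rw [← Finset.card_biUnion hdisj]
    exact Finset.card_le_univ _
  have h2 : m * (κ * Fintype.card E) < ∑ i ∈ Finset.range m,
      ((Finset.univ.filter fun e => d (i + 1) ≤ g e ∧ g e < d i).card : ℝ) := by
    calc m * (κ * Fintype.card E) = ∑ i ∈ Finset.range m, κ * Fintype.card E := by simp
      _ < _ := Finset.sum_lt_sum_of_nonempty (Finset.nonempty_range_iff.2 hm.ne')
          fun i hi => h i (Finset.mem_range.1 hi)
  have h3 : ∑ i ∈ Finset.range m,
      ((Finset.univ.filter fun e => d (i + 1) ≤ g e ∧ g e < d i).card : ℝ) ≤ Fintype.card E := by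
    exact_mod_cast h1
  have h4 : (1 : ℝ) * Fintype.card E ≤ m * κ * Fintype.card E := by gcongr
  linarith

lemma exists_matching_of_isOwned {ε : ℝ} (hε : 0 < ε) :
    ∃ n₀ : ℕ, ∀ n ≥ n₀, ∀ (X C E : Type) [Fintype X] [DecidableEq X] [Fintype C] [DecidableEq C]
      [Fintype E] [DecidableEq E] (o w : E → X) (c : E → C), IsOwned o w c n →
      Fintype.card E = n ^ 2 → Fintype.card (X ⊕ C) = 3 * n →
      ∃ M : Finset E, (∀ e ∈ M, ∀ f ∈ M, e ≠ f →
          o e ≠ o f ∧ o e ≠ w f ∧ w e ≠ w f ∧ c e ≠ c f) ∧ (1 - ε) * n ≤ M.card := by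
  set κ := min (1 / 4) (ε / 6) with hκdef
  have hκ : 0 < κ := lt_min (by norm_num) (by positivity)
  have hκ1 : κ ≤ 1 / 4 := min_le_left _ _
  have hκ2 : κ ≤ ε / 6 := min_le_right _ _
  have hstep : ∀ δ : {δ : ℝ // 0 < δ ∧ δ ≤ 1}, ∃ δ' : {δ : ℝ // 0 < δ ∧ δ ≤ 1},
      (δ' : ℝ) ≤ δ ∧ IsScaleStep κ (ε / 6) δ δ' := fun δ => by
    obtain ⟨δ', h1, h2, h3⟩ := exists_scale hκ hκ1 (ε := ε / 6) (by positivity) δ.2.1 δ.2.2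
    exact ⟨⟨δ', h1, h2.trans δ.2.2⟩, h2, h3⟩
  choose f hf hs using hstep
  choose N hN using hs
  set d : ℕ → {δ : ℝ // 0 < δ ∧ δ ≤ 1} := fun i => f^[i] ⟨1, one_pos, le_rfl⟩ with hd
  have hd1 : ∀ i, d (i + 1) = f (d i) := fun i => Function.iterate_succ_apply' _ _ _
  have hanti : Antitone fun i => (d i : ℝ) := antitone_nat_of_succ_le fun i => by
    rw [hd1]
    exact hf _
  obtain ⟨m, hm⟩ := exists_nat_ge (1 / κ)
  rw [div_le_iff₀ hκ] at hm
  have hm0 : 0 < m := by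
    rcases Nat.eq_zero_or_pos m with rfl | h
    · norm_num at hm
    · exact h
  refine ⟨(Finset.range m).sup fun i => N (d i), fun n hn X C E _ _ _ _ _ _ o w c hG hE hU => ?_⟩
  obtain ⟨i, hi, hwin⟩ := exists_index_card_window_le
    (fun e => (ownCount o c (o e) (c e) : ℝ)) (d := fun i => (d i : ℝ) * n)
    (hanti.mul_const (Nat.cast_nonneg n)) hm0 hm
  have hni : N (d i) ≤ n :=
    (Finset.le_sup (f := fun i => N (d i)) (Finset.mem_range.2 hi)).trans hn
  rw [hE, hd1] at hwin
  push_cast at hwin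
  obtain ⟨M, hM, hcard⟩ := hN (d i) n hni X C E o w c hG hE hwin
  refine ⟨M, hM, hcard.trans' ?_⟩
  rw [hU]
  push_cast
  have h1 : κ * n ≤ ε / 6 * n := by gcongr
  linarith

lemma exists_isOwned {n : ℕ} (c : Fin n × Fin n → Fin n)
    (hc : ∀ k, (Finset.univ.filter fun e => c e = k).card = n) :
    ∃ o w : Fin n × Fin n → Fin n ⊕ Fin n, IsOwned o w c n ∧
      ∀ e v, (o e = v ∨ w e = v) ↔ (Sum.inl e.1 = v ∨ Sum.inr e.2 = v) := by
  set d : Fin n ⊕ Fin n → Fin n → ℕ := incCount (fun e => Sum.inl e.1) (fun e => Sum.inr e.2) c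
    with hd
  set p : Fin n × Fin n → Prop := fun e => d (Sum.inr e.2) (c e) ≤ d (Sum.inl e.1) (c e) with hp
  set o : Fin n × Fin n → Fin n ⊕ Fin n := fun e => if p e then Sum.inl e.1 else Sum.inr e.2
    with ho
  set w : Fin n × Fin n → Fin n ⊕ Fin n := fun e => if p e then Sum.inr e.2 else Sum.inl e.1
    with hw
  have hends : ∀ e v, (o e = v ∨ w e = v) ↔ (Sum.inl e.1 = v ∨ Sum.inr e.2 = v) := fun e v => by
    simp only [ho, hw]
    split_ifs
    exacts [Iff.rfl, or_comm]
  have hinc : ∀ v k, incCount o w c v k = d v k := fun v k => by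
    simp only [incCount, hd, hends]
  refine ⟨o, w, ⟨fun e => ?_, fun e f h => ?_, hc, fun v => ?_, fun e => ?_⟩, hends⟩
  · simp only [ho, hw]
    split_ifs <;> simp
  · have hsame : ∀ v, (o e = v ∨ w e = v) ↔ (o f = v ∨ w f = v) := fun v => by
      rcases h with h | h
      · rw [h.1, h.2]
      · rw [h.1, h.2, or_comm]
    simp only [hends] at hsame
    have h1 := (hsame (Sum.inl e.1)).1 (Or.inl rfl)
    have h2 := (hsame (Sum.inr e.2)).1 (Or.inr rfl)
    simp only [Sum.inl.injEq, Sum.inr.injEq, reduceCtorEq, or_false, false_or] at h1 h2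
    exact Prod.ext h1.symm h2.symm
  · simp only [hends]
    rcases v with a | b
    · have : (Finset.univ.filter fun e : Fin n × Fin n =>
          (Sum.inl e.1 : Fin n ⊕ Fin n) = Sum.inl a ∨ Sum.inr e.2 = Sum.inl a) =
          {a} ×ˢ Finset.univ := by
        ext ⟨x, y⟩
        simp [Finset.mem_product, -Finset.singleton_product, -Finset.product_singleton]
      rw [this]
      simp
    · have : (Finset.univ.filter fun e : Fin n × Fin n =>
          (Sum.inl e.1 : Fin n ⊕ Fin n) = Sum.inr b ∨ (Sum.inr e.2 : Fin n ⊕ Fin n) = Sum.inr b) =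
          Finset.univ ×ˢ {b} := by
        ext ⟨x, y⟩
        simp [Finset.mem_product, -Finset.singleton_product, -Finset.product_singleton]
      rw [this]
      simp
  · rw [hinc, hinc]
    simp only [ho, hw]
    split_ifs with h
    · exact h
    · exact (not_le.1 h).le

/-- Chakraborti–Christoph–Hunter–Montgomery–Petrov: For every `ε > 0` and
sufficiently large `n`, every (not necessarily proper) coloring of `K_{n,n}` with `n` colors
in which each color appears on exactly `n` edges contains a rainbow matching with at least
`(1 - ε) n` edges. Edges of `K_{n,n}` are modeled as pairs `(i, j) ∈ Fin n × Fin n`. -/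
theorem almost_full_transversal_equi_n_square (ε : ℝ) (hε : 0 < ε) :
    ∃ n₀ : ℕ, ∀ n : ℕ, n₀ ≤ n →
      ∀ c : Fin n × Fin n → Fin n,
        (∀ k : Fin n, (Finset.univ.filter fun e : Fin n × Fin n => c e = k).card = n) →
        ∃ s : Finset (Fin n × Fin n),
          (1 - ε) * (n : ℝ) ≤ (s.card : ℝ) ∧
          (∀ e ∈ s, ∀ e' ∈ s, e ≠ e' → e.1 ≠ e'.1 ∧ e.2 ≠ e'.2) ∧
          Set.InjOn c ↑s := by
  obtain ⟨n₀, H⟩ := exists_matching_of_isOwned hε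
  refine ⟨n₀, fun n hn c hc => ?_⟩
  obtain ⟨o, w, hG, hends⟩ := exists_isOwned c hc
  obtain ⟨M, hM, hcard⟩ := H n hn _ _ _ o w c hG (by simp [sq]) (by simp; ring)
  have hdisj : ∀ e ∈ M, ∀ f ∈ M, e ≠ f → ∀ v, (o e = v ∨ w e = v) → ¬ (o f = v ∨ w f = v) := by
    intro e he f hf hef v h1 h2
    obtain ⟨h3, h4, h5, -⟩ := hM e he f hf hef
    obtain ⟨-, h6, -⟩ := hM f hf e he hef.symm
    grind
  simp only [hends] at hdisj
  refine ⟨M, hcard, fun e he f hf hef => ⟨fun h => ?_, fun h => ?_⟩, fun e he f hf hef => ?_⟩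
  · exact hdisj e he f hf hef (Sum.inl e.1) (Or.inl rfl) (Or.inl (by rw [h]))
  · exact hdisj e he f hf hef (Sum.inr e.2) (Or.inr rfl) (Or.inr (by rw [h]))
  · by_contra h
    exact (hM e he f hf h).2.2.2 hef
end
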